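/- arXiv:0710.0946 — 4 statements merged into one kernel-verified Lean document; each statement's English description precedes it below -/
import Mathlib

section
/- Let l, r ≥ 0, let 1 ≤ p_1 ≤ … ≤ p_l and q_1 ≥ … ≥ q_r ≥ 1 be integers; let C ∈ ℝ^{c×c} be a real Jordan canonical matrix, C = block-diag over distinct complex numbers λ_1,…,λ_s with Im λ_i ≥ 0 of diag(J^ℝ_{s_{i1}}(λ_i), J^ℝ_{s_{i2}}(λ_i),…) with s_{i1} ≥ s_{i2} ≥ … (each s_{ij} even when Im λ_i > 0); and let D = diag(J_{d_1},…,J_{d_u}) with d_1 ≥ … ≥ d_u ≥ 1 be a nilpotent Jordan matrix of size d. Let A ∈ ℝ^{m×n} be block-diagonal with diagonal blocks F_{p_1},…,F_{p_l}, I_c, D, F_{q_1}^T,…,F_{q_r}^T, and let B ∈ ℝ^{m×n} be block-diagonal with diagonal blocks K_{p_1},…,K_{p_l}, C, I_d, K_{q_1}^T,…,K_{q_r}^T in the same row and column partition. Let 𝒫 ⊆ ℝ^{m×n} × ℝ^{m×n} consist of the pairs (P,Q) supported exactly as in the complex version of the theorem, namely: P only on (i) for each i ≤ l, the last row of the block (rows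 of F_{p_i}, columns of D); (ii) for each i ≤ l, j ≤ r, the last column of the block (rows of F_{p_i}, columns of F_{q_j}^T); (iii) for each j ≤ r, the last column of the block (rows of D, columns of F_{q_j}^T); (iv) inside the D-block, for each ordered pair (k,k') of Jordan blocks of D, the first column of the d_k×d_{k'} sub-block if d_k ≤ d_{k'} and its last row if d_k > d_{k'}; and Q only on (i) for i < j ≤ l, the first max(p_j−1−p_i, 0) entries of the first row of the block (rows of K_{p_i}, columns of K_{p_j}); (ii) for each i ≤ l, the first row of the block (rows of K_{p_i}, columns of C); (iii) for each i ≤ l, j ≤ r, the first row of the block (rows of K_{p_i}, columns of K_{q_j}^T); (iv) inside the C-block, for each ordered pair of real Jordan blocks of C with the same λ_i and sizes p (row block) and q (column block), the first column of the p×q sub-block if p ≤ q and its last row if p > q; (v) for each j ≤ r, the first column of the block (rows of C, columns of K_{q_j}^T); (vi) for i < j ≤ r, the first max(q_i−1−q_j, 0) entries of the first column of the block (rows of K_{q_i}^T, columns of K_{q_j}^T). Then ℝ^{m×n} × ℝ^{m×n} is the internal direct sum of 𝒫 and the subspace {(SA − AR, SB − BR) : S ∈ ℝ^{m×m}, R ∈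 ℝ^{n×n}}. -/
open Matrix

namespace KroneckerReal

/-- Entry `(a, b)` (0-indexed) of the real Jordan block `J^ℝ_r(lam)`. -/
noncomputable def realJordanEntry (lam : ℂ) (a b : ℕ) : ℝ :=
  if lam.im = 0 then
    (if a = b then lam.re else if b = a + 1 then 1 else 0)
  else if a / 2 = b / 2 then
    (if a % 2 = b % 2 then lam.re else if a % 2 = 0 then lam.im else -lam.im)
  else if b / 2 = a / 2 + 1 ∧ a % 2 = b % 2 then 1 else 0

variable (l r : ℕ) (p : Fin l → ℕ) (q : Fin r → ℕ)
variable (s : ℕ) (lamC : Fin s → ℂ) (tC : Fin s → ℕ) (szC : ∀ i : Fin s, Fin (tC i) → ℕ)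
variable (u : ℕ) (dsz : Fin u → ℕ)

/-- Index set of the real Jordan canonical matrix `C`. -/
abbrev CI := Σ i : Fin s, Σ j : Fin (tC i), Fin (szC i j)

/-- Index set of the nilpotent Jordan matrix `D`. -/
abbrev DI := Σ k : Fin u, Fin (dsz k)

/-- Row indices: rows of the blocks `F_{p_1}, …, F_{p_l}, I_c, D, F_{q_1}^T, …, F_{q_r}^T`. -/
abbrev Row := (Σ i : Fin l, Fin (p i)) ⊕
  (CI s tC szC ⊕ (DI u dsz ⊕ (Σ j : Fin r, Fin (q j - 1))))

/-- Column indices: columns of the same blocks. -/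
abbrev Col := (Σ i : Fin l, Fin (p i - 1)) ⊕
  (CI s tC szC ⊕ (DI u dsz ⊕ (Σ j : Fin r, Fin (q j))))

/-- The first matrix `A` of the real Kronecker pair: block-diagonal with blocks
`F_{p_i}`, `I_c`, `D`, `F_{q_j}^T`. -/
def A : Matrix (Row l r p q s tC szC u dsz) (Col l r p q s tC szC u dsz) ℝ :=
  Matrix.of fun x y =>
    match x, y with
    | Sum.inl ⟨i, a⟩, Sum.inl ⟨i', b⟩ =>
        if i = i' ∧ (a : ℕ) = (b : ℕ) then 1 else 0
    | Sum.inr (Sum.inl c), Sum.inr (Sum.inl c') => if c = c' then 1 else 0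
    | Sum.inr (Sum.inr (Sum.inl ⟨k, a⟩)), Sum.inr (Sum.inr (Sum.inl ⟨k', b⟩)) =>
        if k = k' ∧ (b : ℕ) = (a : ℕ) + 1 then 1 else 0
    | Sum.inr (Sum.inr (Sum.inr ⟨j, a⟩)), Sum.inr (Sum.inr (Sum.inr ⟨j', b⟩)) =>
        if j = j' ∧ (a : ℕ) = (b : ℕ) then 1 else 0
    | _, _ => 0

/-- The second matrix `B` of the real Kronecker pair: block-diagonal with blocks
`K_{p_i}`, `C`, `I_d`, `K_{q_j}^T`. -/
noncomputable def B :
    Matrix (Row l r p q s tC szC u dsz) (Col l r p q s tC szC u dsz) ℝ :=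
  Matrix.of fun x y =>
    match x, y with
    | Sum.inl ⟨i, a⟩, Sum.inl ⟨i', b⟩ =>
        if i = i' ∧ (a : ℕ) = (b : ℕ) + 1 then 1 else 0
    | Sum.inr (Sum.inl c), Sum.inr (Sum.inl c') =>
        if c.1 = c'.1 ∧ (c.2.1 : ℕ) = (c'.2.1 : ℕ) then
          realJordanEntry (lamC c.1) c.2.2 c'.2.2 else 0
    | Sum.inr (Sum.inr (Sum.inl d1)), Sum.inr (Sum.inr (Sum.inl d2)) =>
        if d1 = d2 then 1 else 0
    | Sum.inr (Sum.inr (Sum.inr ⟨j, a⟩)), Sum.inr (Sum.inr (Sum.inr ⟨j', b⟩)) =>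
        if j = j' ∧ (b : ℕ) = (a : ℕ) + 1 then 1 else 0
    | _, _ => 0

/-- Support of the first component `P` of the miniversal deformation. -/
def PSupp : Row l r p q s tC szC u dsz → Col l r p q s tC szC u dsz → Prop
  | Sum.inl ⟨i, a⟩, Sum.inr (Sum.inr (Sum.inl _)) => (a : ℕ) = p i - 1
  | Sum.inl _, Sum.inr (Sum.inr (Sum.inr ⟨j, b⟩)) => (b : ℕ) = q j - 1
  | Sum.inr (Sum.inr (Sum.inl _)), Sum.inr (Sum.inr (Sum.inr ⟨j, b⟩)) => (b : ℕ) = q j - 1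
  | Sum.inr (Sum.inr (Sum.inl ⟨k, a⟩)), Sum.inr (Sum.inr (Sum.inl ⟨k', b⟩)) =>
      (dsz k ≤ dsz k' ∧ (b : ℕ) = 0) ∨ (dsz k' < dsz k ∧ (a : ℕ) = dsz k - 1)
  | _, _ => False

/-- Support of the second component `Q` of the miniversal deformation. -/
def QSupp : Row l r p q s tC szC u dsz → Col l r p q s tC szC u dsz → Prop
  | Sum.inl ⟨i, a⟩, Sum.inl ⟨j, b⟩ =>
      i < j ∧ (a : ℕ) = 0 ∧ (b : ℕ) < p j - 1 - p i
  | Sum.inl ⟨_, a⟩, Sum.inr (Sum.inl _) => (a : ℕ) = 0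
  | Sum.inl ⟨_, a⟩, Sum.inr (Sum.inr (Sum.inr _)) => (a : ℕ) = 0
  | Sum.inr (Sum.inl c), Sum.inr (Sum.inl c') =>
      c.1 = c'.1 ∧
        ((szC c.1 c.2.1 ≤ szC c'.1 c'.2.1 ∧ (c'.2.2 : ℕ) = 0) ∨
         (szC c'.1 c'.2.1 < szC c.1 c.2.1 ∧ (c.2.2 : ℕ) = szC c.1 c.2.1 - 1))
  | Sum.inr (Sum.inl _), Sum.inr (Sum.inr (Sum.inr ⟨_, b⟩)) => (b : ℕ) = 0
  | Sum.inr (Sum.inr (Sum.inr ⟨i, a⟩)), Sum.inr (Sum.inr (Sum.inr ⟨j, b⟩)) =>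
      i < j ∧ (b : ℕ) = 0 ∧ (a : ℕ) < q i - 1 - q j
  | _, _ => False

/-- Under the tangent map `(S, R) ↦ (S A₂ - A₁ R, S B₂ - B₁ R)`, the pairs of matrices supported
on `P` and `Q` form a complement of the range. -/
def Complementary {ρ₁ κ₁ ρ₂ κ₂ : Type*} [Fintype ρ₂] [Fintype κ₁]
    (A₁ B₁ : Matrix ρ₁ κ₁ ℝ) (A₂ B₂ : Matrix ρ₂ κ₂ ℝ) (P Q : ρ₁ → κ₂ → Prop) : Prop :=
  (∀ M N : Matrix ρ₁ κ₂ ℝ, ∃ (S : Matrix ρ₁ ρ₂ ℝ) (R : Matrix κ₁ κ₂ ℝ),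
    (∀ x y, ¬ P x y → (S * A₂) x y - (A₁ * R) x y = M x y) ∧
    (∀ x y, ¬ Q x y → (S * B₂) x y - (B₁ * R) x y = N x y)) ∧
  (∀ (S : Matrix ρ₁ ρ₂ ℝ) (R : Matrix κ₁ κ₂ ℝ),
    (∀ x y, ¬ P x y → (S * A₂) x y = (A₁ * R) x y) →
    (∀ x y, ¬ Q x y → (S * B₂) x y = (B₁ * R) x y) →
    (∀ x y, (S * A₂) x y = (A₁ * R) x y) ∧ ∀ x y, (S * B₂) x y = (B₁ * R) x y)

namespace Complementary

section Symmetry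

variable {ρ₁ κ₁ ρ₂ κ₂ : Type*} [Fintype ρ₂] [Fintype κ₁]
  {A₁ B₁ : Matrix ρ₁ κ₁ ℝ} {A₂ B₂ : Matrix ρ₂ κ₂ ℝ} {P Q : ρ₁ → κ₂ → Prop}

theorem swap (h : Complementary A₁ B₁ A₂ B₂ P Q) : Complementary B₁ A₁ B₂ A₂ Q P := by
  refine ⟨fun M N => ?_, fun S R h₁ h₂ => (h.2 S R h₂ h₁).symm⟩
  obtain ⟨S, R, h₁, h₂⟩ := h.1 N M
  exact ⟨S, R, h₂, h₁⟩

theorem congr_supp (h : Complementary A₁ B₁ A₂ B₂ P Q) {P' Q' : ρ₁ → κ₂ → Prop}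
    (hP : ∀ x y, P' x y ↔ P x y) (hQ : ∀ x y, Q' x y ↔ Q x y) :
    Complementary A₁ B₁ A₂ B₂ P' Q' := by
  obtain rfl : P' = P := by ext; apply hP
  obtain rfl : Q' = Q := by ext; apply hQ
  exact h

theorem transpose (h : Complementary A₁ B₁ A₂ B₂ P Q) :
    Complementary A₂ᵀ B₂ᵀ A₁ᵀ B₁ᵀ (fun y x => P x y) (fun y x => Q x y) := by
  have key : ∀ (A : Matrix ρ₁ κ₁ ℝ) (R : Matrix κ₂ κ₁ ℝ) (x : ρ₁) (y : κ₂),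
      (R * Aᵀ) y x = (A * Rᵀ) x y := fun A R x y => by
    rw [← Matrix.transpose_apply (R * Aᵀ), Matrix.transpose_mul, Matrix.transpose_transpose]
  have key' : ∀ (A : Matrix ρ₂ κ₂ ℝ) (S : Matrix ρ₂ ρ₁ ℝ) (x : ρ₁) (y : κ₂),
      (Aᵀ * S) y x = (Sᵀ * A) x y := fun A S x y => by
    rw [← Matrix.transpose_apply (Aᵀ * S), Matrix.transpose_mul, Matrix.transpose_transpose]
  constructor
  · intro M N
    obtain ⟨S, R, h₁, h₂⟩ := h.1 (-Mᵀ) (-Nᵀ)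
    refine ⟨Rᵀ, Sᵀ, fun y x hP => ?_, fun y x hQ => ?_⟩
    · have := h₁ x y hP
      simp only [key, key', Matrix.transpose_transpose, Matrix.neg_apply,
        Matrix.transpose_apply] at this ⊢
      linarith
    · have := h₂ x y hQ
      simp only [key, key', Matrix.transpose_transpose, Matrix.neg_apply,
        Matrix.transpose_apply] at this ⊢
      linarith
  · intro R S h₁ h₂
    simp only [key, key'] at h₁ h₂ ⊢
    obtain ⟨h₃, h₄⟩ := h.2 Sᵀ Rᵀ (fun x y hP => (h₁ y x hP).symm) fun x y hQ => (h₂ y x hQ).symm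
    exact ⟨fun y x => (h₃ x y).symm, fun y x => (h₄ x y).symm⟩

theorem submatrix {ρ₁' κ₁' ρ₂' κ₂' : Type*} [Fintype ρ₂'] [Fintype κ₁']
    (h : Complementary A₁ B₁ A₂ B₂ P Q)
    (e₁ : ρ₁' ≃ ρ₁) (f₁ : κ₁' ≃ κ₁) (e₂ : ρ₂' ≃ ρ₂) (f₂ : κ₂' ≃ κ₂) :
    Complementary (A₁.submatrix e₁ f₁) (B₁.submatrix e₁ f₁) (A₂.submatrix e₂ f₂)
      (B₂.submatrix e₂ f₂) (fun x y => P (e₁ x) (f₂ y)) (fun x y => Q (e₁ x) (f₂ y)) := by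
  have key : ∀ (A : Matrix ρ₂ κ₂ ℝ) (S : Matrix ρ₁ ρ₂ ℝ),
      S.submatrix e₁ e₂ * A.submatrix e₂ f₂ = (S * A).submatrix e₁ f₂ :=
    fun A S => Matrix.submatrix_mul_equiv S A e₁ e₂ f₂
  have key' : ∀ (A : Matrix ρ₁ κ₁ ℝ) (R : Matrix κ₁ κ₂ ℝ),
      A.submatrix e₁ f₁ * R.submatrix f₁ f₂ = (A * R).submatrix e₁ f₂ :=
    fun A R => Matrix.submatrix_mul_equiv A R e₁ f₁ f₂
  constructor
  · intro M N
    obtain ⟨S, R, h₁, h₂⟩ := h.1 (M.submatrix e₁.symm f₂.symm) (N.submatrix e₁.symm f₂.symm)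
    refine ⟨S.submatrix e₁ e₂, R.submatrix f₁ f₂, fun x y hP => ?_, fun x y hQ => ?_⟩
    · simpa only [key, key', Matrix.submatrix_apply, Equiv.symm_apply_apply] using h₁ _ _ hP
    · simpa only [key, key', Matrix.submatrix_apply, Equiv.symm_apply_apply] using h₂ _ _ hQ
  · intro S R h₁ h₂
    obtain ⟨S, rfl⟩ : ∃ S' : Matrix ρ₁ ρ₂ ℝ, S = S'.submatrix e₁ e₂ :=
      ⟨S.submatrix e₁.symm e₂.symm, by ext; simp⟩
    obtain ⟨R, rfl⟩ : ∃ R' : Matrix κ₁ κ₂ ℝ, R = R'.submatrix f₁ f₂ :=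
      ⟨R.submatrix f₁.symm f₂.symm, by ext; simp⟩
    simp only [key, key', Matrix.submatrix_apply] at h₁ h₂ ⊢
    obtain ⟨h₃, h₄⟩ := h.2 S R
      (fun x y hP => by simpa using h₁ (e₁.symm x) (f₂.symm y) (by simpa using hP))
      (fun x y hQ => by simpa using h₂ (e₁.symm x) (f₂.symm y) (by simpa using hQ))
    exact ⟨fun x y => h₃ _ _, fun x y => h₄ _ _⟩

end Symmetry

/-- Complements can be chosen block by block for block-diagonal pencils. -/
theorem of_blocks {T : Type*} [Fintype T] [DecidableEq T] {ρ κ : T → Type*}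
    [∀ t, Fintype (ρ t)] [∀ t, Fintype (κ t)]
    {A B : Matrix (Σ t, ρ t) (Σ t, κ t) ℝ} {P Q : (Σ t, ρ t) → (Σ t, κ t) → Prop}
    (hA : ∀ t t' a b, t ≠ t' → A ⟨t, a⟩ ⟨t', b⟩ = 0)
    (hB : ∀ t t' a b, t ≠ t' → B ⟨t, a⟩ ⟨t', b⟩ = 0)
    (h : ∀ t t', Complementary
      (Matrix.of fun a b => A ⟨t, a⟩ ⟨t, b⟩) (Matrix.of fun a b => B ⟨t, a⟩ ⟨t, b⟩)
      (Matrix.of fun a b => A ⟨t', a⟩ ⟨t', b⟩) (Matrix.of fun a b => B ⟨t', a⟩ ⟨t', b⟩)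
      (fun a b => P ⟨t, a⟩ ⟨t', b⟩) (fun a b => Q ⟨t, a⟩ ⟨t', b⟩)) :
    Complementary A B A B P Q := by
  have left : ∀ {A : Matrix (Σ t, ρ t) (Σ t, κ t) ℝ}
      (_ : ∀ t t' a b, t ≠ t' → A ⟨t, a⟩ ⟨t', b⟩ = 0) (S : Matrix (Σ t, ρ t) (Σ t, ρ t) ℝ)
      (t t' : T) (a : ρ t) (b : κ t'), (S * A) ⟨t, a⟩ ⟨t', b⟩ =
        ((Matrix.of fun (a : ρ t) (c : ρ t') => S ⟨t, a⟩ ⟨t', c⟩) *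
          (Matrix.of fun a b => A ⟨t', a⟩ ⟨t', b⟩)) a b := by
    intro A hA S t t' a b
    simp only [Matrix.mul_apply, Fintype.sum_sigma, Matrix.of_apply]
    refine Finset.sum_eq_single t' (fun u _ hu => ?_) (by simp)
    exact Finset.sum_eq_zero fun c _ => by rw [hA u t' c b hu, mul_zero]
  have right : ∀ {A : Matrix (Σ t, ρ t) (Σ t, κ t) ℝ}
      (_ : ∀ t t' a b, t ≠ t' → A ⟨t, a⟩ ⟨t', b⟩ = 0) (R : Matrix (Σ t, κ t) (Σ t, κ t) ℝ)
      (t t' : T) (a : ρ t) (b : κ t'), (A * R) ⟨t, a⟩ ⟨t', b⟩ =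
        ((Matrix.of fun a b => A ⟨t, a⟩ ⟨t, b⟩) *
          (Matrix.of fun (c : κ t) (b : κ t') => R ⟨t, c⟩ ⟨t', b⟩)) a b := by
    intro A hA R t t' a b
    simp only [Matrix.mul_apply, Fintype.sum_sigma, Matrix.of_apply]
    refine Finset.sum_eq_single t (fun u _ hu => ?_) (by simp)
    exact Finset.sum_eq_zero fun c _ => by rw [hA t u a c hu.symm, zero_mul]
  constructor
  · intro M N
    choose S R hS hR using fun t t' => (h t t').1
      (Matrix.of fun a b => M ⟨t, a⟩ ⟨t', b⟩) (Matrix.of fun a b => N ⟨t, a⟩ ⟨t', b⟩)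
    refine ⟨Matrix.of fun x y => S x.1 y.1 x.2 y.2, Matrix.of fun x y => R x.1 y.1 x.2 y.2, ?_, ?_⟩
    · rintro ⟨t, a⟩ ⟨t', b⟩ hP
      rw [left hA, right hA]
      exact hS t t' a b hP
    · rintro ⟨t, a⟩ ⟨t', b⟩ hQ
      rw [left hB, right hB]
      exact hR t t' a b hQ
  · intro S R h₁ h₂
    have := fun t t' => (h t t').2 (Matrix.of fun a c => S ⟨t, a⟩ ⟨t', c⟩)
      (Matrix.of fun c b => R ⟨t, c⟩ ⟨t', b⟩)
      (fun a b hP => by rw [← left hA, ← right hA]; exact h₁ _ _ hP)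
      (fun a b hQ => by rw [← left hB, ← right hB]; exact h₂ _ _ hQ)
    constructor
    · rintro ⟨t, a⟩ ⟨t', b⟩
      rw [left hA, right hA]
      exact (this t t').1 a b
    · rintro ⟨t, a⟩ ⟨t', b⟩
      rw [left hB, right hB]
      exact (this t t').2 a b

end Complementary

/-- The `n × (n - 1)` block `F_n`. -/
def blockF (n : ℕ) : Matrix (Fin n) (Fin (n - 1)) ℝ :=
  Matrix.of fun a b => if (a : ℕ) = b then 1 else 0

/-- The `n × (n - 1)` block `K_n`. -/
def blockK (n : ℕ) : Matrix (Fin n) (Fin (n - 1)) ℝ :=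
  Matrix.of fun a b => if (a : ℕ) = b + 1 then 1 else 0

section Products

variable {κ : Type*} {n : ℕ}

theorem mul_blockF (S : Matrix κ (Fin n) ℝ) (x : κ) (b : Fin (n - 1)) :
    (S * blockF n) x b = S x ⟨b, by omega⟩ := by
  rw [Matrix.mul_apply, Finset.sum_eq_single ⟨b, by omega⟩]
  · simp [blockF]
  · intro c _ hc
    simp [blockF, Fin.ext_iff] at hc ⊢
    exact fun h => absurd h hc
  · simp

theorem mul_blockK (S : Matrix κ (Fin n) ℝ) (x : κ) (b : Fin (n - 1)) :
    (S * blockK n) x b = S x ⟨b + 1, by omega⟩ := by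
  rw [Matrix.mul_apply, Finset.sum_eq_single ⟨b + 1, by omega⟩]
  · simp [blockK]
  · intro c _ hc
    simp [blockK, Fin.ext_iff] at hc ⊢
    exact fun h => absurd h hc
  · simp

theorem blockF_mul (R : Matrix (Fin (n - 1)) κ ℝ) (a : Fin n) (y : κ) :
    (blockF n * R) a y = if h : (a : ℕ) < n - 1 then R ⟨a, h⟩ y else 0 := by
  rw [Matrix.mul_apply]
  split_ifs with h
  · rw [Finset.sum_eq_single ⟨a, h⟩]
    · simp [blockF]
    · intro c _ hc
      simp [blockF, Fin.ext_iff] at hc ⊢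
      exact fun h => absurd h.symm hc
    · simp
  · refine Finset.sum_eq_zero fun c _ => ?_
    have : (a : ℕ) ≠ c := by omega
    simp [blockF, this]

theorem blockK_mul (R : Matrix (Fin (n - 1)) κ ℝ) (a : Fin n) (y : κ) :
    (blockK n * R) a y = if h : 0 < (a : ℕ) then R ⟨a - 1, by omega⟩ y else 0 := by
  rw [Matrix.mul_apply]
  split_ifs with h
  · rw [Finset.sum_eq_single ⟨a - 1, by omega⟩]
    · have : (a : ℕ) = a - 1 + 1 := by omega
      simp [blockK, ← this]
    · intro c _ hc
      simp [blockK, Fin.ext_iff] at hc ⊢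
      omega
    · simp
  · refine Finset.sum_eq_zero fun c _ => ?_
    have : (a : ℕ) ≠ c + 1 := by omega
    simp [blockK, this]

theorem mul_blockF_transpose (S : Matrix κ (Fin (n - 1)) ℝ) (x : κ) (b : Fin n) :
    (S * (blockF n)ᵀ) x b = if h : (b : ℕ) < n - 1 then S x ⟨b, h⟩ else 0 := by
  have := blockF_mul Sᵀ b x
  rwa [← Matrix.transpose_apply (blockF n * Sᵀ), Matrix.transpose_mul,
    Matrix.transpose_transpose] at this

theorem mul_blockK_transpose (S : Matrix κ (Fin (n - 1)) ℝ) (x : κ) (b : Fin n) :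
    (S * (blockK n)ᵀ) x b = if h : 0 < (b : ℕ) then S x ⟨b - 1, by omega⟩ else 0 := by
  have := blockK_mul Sᵀ b x
  rwa [← Matrix.transpose_apply (blockK n * Sᵀ), Matrix.transpose_mul,
    Matrix.transpose_transpose] at this

theorem blockF_transpose_mul (R : Matrix (Fin n) κ ℝ) (a : Fin (n - 1)) (y : κ) :
    ((blockF n)ᵀ * R) a y = R ⟨a, by omega⟩ y := by
  have := mul_blockF Rᵀ y a
  rwa [← Matrix.transpose_apply (Rᵀ * blockF n), Matrix.transpose_mul,
    Matrix.transpose_transpose] at this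

theorem blockK_transpose_mul (R : Matrix (Fin n) κ ℝ) (a : Fin (n - 1)) (y : κ) :
    ((blockK n)ᵀ * R) a y = R ⟨a + 1, by omega⟩ y := by
  have := mul_blockK Rᵀ y a
  rwa [← Matrix.transpose_apply (Rᵀ * blockK n), Matrix.transpose_mul,
    Matrix.transpose_transpose] at this

theorem blockF_submatrix_rev (n : ℕ) :
    (blockF n).submatrix Fin.revPerm Fin.revPerm = blockK n := by
  ext a b
  simp only [blockF, blockK, Matrix.submatrix_apply, Matrix.of_apply, Fin.revPerm_apply,
    Fin.val_rev]
  congr 1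
  simp only [eq_iff_iff]
  omega

theorem blockK_submatrix_rev (n : ℕ) :
    (blockK n).submatrix Fin.revPerm Fin.revPerm = blockF n := by
  ext a b
  simp only [blockF, blockK, Matrix.submatrix_apply, Matrix.of_apply, Fin.revPerm_apply,
    Fin.val_rev]
  congr 1
  simp only [eq_iff_iff]
  omega

end Products

theorem exists_downward_rec {V : Type*} (n : ℕ) (v : V) (f : ℕ → V → V) :
    ∃ X : ℕ → V, X n = v ∧ ∀ a < n, X a = f a (X (a + 1)) := by
  refine ⟨fun a => Nat.rec v (fun k x => f (n - 1 - k) x) (n - a), by simp, fun a ha => ?_⟩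
  obtain ⟨k, rfl⟩ : ∃ k, n = a + 1 + k := ⟨n - a - 1, by omega⟩
  have h₁ : a + 1 + k - a = k + 1 := by omega
  have h₂ : a + 1 + k - (a + 1) = k := by omega
  have h₃ : a + 1 + k - 1 - k = a := by omega
  simp only [h₁, h₂, h₃]

theorem exists_upward_rec {V : Type*} (v : V) (f : ℕ → V → V) :
    ∃ X : ℕ → V, X 0 = v ∧ ∀ a, X (a + 1) = f a (X a) :=
  ⟨fun a => Nat.rec v f a, rfl, fun _ => rfl⟩

theorem exists_nat_extension {m n : ℕ} (M : Matrix (Fin m) (Fin n) ℝ) :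
    ∃ M' : ℕ → ℕ → ℝ, ∀ a b, M a b = M' a b :=
  ⟨fun a b => if h : a < m ∧ b < n then M ⟨a, h.1⟩ ⟨b, h.2⟩ else 0, fun a b => by simp⟩

theorem exists_row_extension {m : ℕ} {κ : Type*} (M : Matrix (Fin m) κ ℝ) :
    ∃ M' : ℕ → κ → ℝ, ∀ a b, M a b = M' a b :=
  ⟨fun a b => if h : a < m then M ⟨a, h⟩ b else 0, fun a b => by simp⟩

section KroneckerPairs

variable {κ : Type*} [Fintype κ] [DecidableEq κ]

theorem complementary_blockF_blockF (m n : ℕ) :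
    Complementary (blockF m) (blockK m) (blockF n) (blockK n) (fun _ _ => False)
      (fun a b => (a : ℕ) = 0 ∧ (b : ℕ) < n - 1 - m) := by
  constructor
  · intro M N
    obtain ⟨M, hM⟩ := exists_nat_extension M
    obtain ⟨N, hN⟩ := exists_nat_extension N
    obtain ⟨D, hD₀, hD⟩ := exists_downward_rec (m - 1) (fun b => M (m - 1) b)
      (fun a (x : ℕ → ℝ) b => x (b + 1) - (N (a + 1) b - M a b))
    obtain ⟨U, hU₀, hU⟩ := exists_upward_rec (fun b => N 0 (b - 1))
      (fun a (x : ℕ → ℝ) b => x (b - 1) + (N (a + 1) (b - 1) - M a (b - 1)))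
    obtain ⟨S, hS⟩ : ∃ S : ℕ → ℕ → ℝ, ∀ a b,
        S a b = if b ≤ a + (n - 1 - m) then D a b else U a b := ⟨_, fun _ _ => rfl⟩
    have hdiag : ∀ a b, a < m - 1 → S (a + 1) (b + 1) = S a b + (N (a + 1) b - M a b) := by
      intro a b ha
      rw [hS, hS]
      by_cases h : b ≤ a + (n - 1 - m)
      · rw [if_pos h, if_pos (by omega), hD a ha]
        ring
      · rw [if_neg h, if_neg (by omega), hU]
        simp
    refine ⟨Matrix.of fun a b => S a b, Matrix.of fun a b => S a b - M a b, fun a b _ => ?_,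
      fun a b hab => ?_⟩
    · rw [mul_blockF, blockF_mul, hM]
      simp only [Matrix.of_apply]
      split_ifs with h
      · ring
      · obtain rfl | h' : m = 0 ∨ (a : ℕ) = m - 1 := by omega
        · exact a.elim0
        · rw [hS, if_pos (by omega), h', hD₀, sub_zero]
    · rw [mul_blockK, blockK_mul, hN]
      simp only [Matrix.of_apply]
      split_ifs with h
      · obtain ⟨c, hc⟩ : ∃ c, (a : ℕ) = c + 1 := ⟨a - 1, by omega⟩
        rw [hc, hdiag c b (by omega), Nat.add_sub_cancel]
        ring
      · have h' : (a : ℕ) = 0 := by omega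
        rw [hS, if_neg (by omega), h', hU₀]
        simp
  · intro S R h₁ h₂
    refine ⟨fun a b => h₁ a b id, fun a b => ?_⟩
    by_cases hab : (a : ℕ) = 0 ∧ (b : ℕ) < n - 1 - m
    swap
    · exact h₂ a b hab
    simp only [mul_blockF, blockF_mul, mul_blockK, blockK_mul] at h₁ h₂ ⊢
    have key : ∀ k (hk : k < m), S ⟨0, by omega⟩ ⟨b + 1, by omega⟩ =
        S ⟨k, hk⟩ ⟨b + 1 + k, by omega⟩ := by
      intro k
      induction k with
      | zero => exact fun _ => rfl
      | succ k ih =>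
        intro hk
        have e₁ := h₁ ⟨k, by omega⟩ ⟨b + 1 + k, by omega⟩ id
        have e₂ := h₂ ⟨k + 1, hk⟩ ⟨b + 1 + k, by omega⟩ (by simp)
        rw [dif_pos (show k < m - 1 by omega)] at e₁
        rw [dif_pos (Nat.succ_pos k)] at e₂
        rw [ih (by omega), e₁]
        exact e₂.symm
    have e := h₁ ⟨m - 1, by omega⟩ ⟨b + m, by omega⟩ id
    rw [dif_neg (by simp)] at e
    have ha : a = ⟨0, by omega⟩ := Fin.ext hab.1
    rw [dif_neg (by omega), ha, key (m - 1) (by omega), ← e]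
    have : (b : ℕ) + 1 + (m - 1) = b + m := by omega
    simp only [this]

theorem complementary_blockF_regular (m : ℕ) (C : Matrix κ κ ℝ) :
    Complementary (blockF m) (blockK m) 1 C (fun _ _ => False) (fun a _ => (a : ℕ) = 0) := by
  constructor
  · intro M N
    obtain ⟨M, hM⟩ := exists_row_extension M
    obtain ⟨N, hN⟩ := exists_row_extension N
    obtain ⟨X, hX₀, hX⟩ := exists_downward_rec (m - 1) (0 : κ → ℝ)
      (fun a x => Matrix.vecMul (M (a + 1) + x) C - N (a + 1))
    refine ⟨Matrix.of fun a y => M a y + X a y, Matrix.of fun a y => X a y, fun a y _ => ?_,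
      fun a y ha => ?_⟩
    · rw [Matrix.mul_one, blockF_mul, hM]
      simp only [Matrix.of_apply]
      split_ifs with h
      · ring
      · have : (a : ℕ) = m - 1 := by omega
        rw [this, hX₀]
        simp
    · rw [blockK_mul, hN, dif_pos (by omega)]
      obtain ⟨c, hc⟩ : ∃ c, (a : ℕ) = c + 1 := ⟨a - 1, by omega⟩
      simp only [Matrix.of_apply, hc, Nat.add_sub_cancel, Matrix.mul_apply, hX c (by omega)]
      simp [Matrix.vecMul, dotProduct]
  · intro S R h₁ h₂
    simp only [blockF_mul, blockK_mul, Matrix.mul_one] at h₁ h₂ ⊢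
    have hR : ∀ k (a : Fin (m - 1)) y, (a : ℕ) + 1 + k = m - 1 → R a y = 0 := by
      intro k
      induction k with
      | zero =>
        intro a y ha
        have e := h₂ ⟨a + 1, by omega⟩ y (by simp)
        rw [dif_pos (by simp), Matrix.mul_apply] at e
        refine e.symm.trans (Finset.sum_eq_zero fun c _ => ?_)
        rw [h₁ _ _ id, dif_neg (by simp; omega), zero_mul]
      | succ k ih =>
        intro a y ha
        have e := h₂ ⟨a + 1, by omega⟩ y (by simp)
        rw [dif_pos (by simp), Matrix.mul_apply] at e
        refine e.symm.trans (Finset.sum_eq_zero fun c _ => ?_)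
        rw [h₁ _ _ id, dif_pos (by simp; omega), ih _ _ (by simp; omega), zero_mul]
    have hR' : R = 0 := by
      ext a y
      exact hR (m - 1 - 1 - a) a y (by omega)
    subst hR'
    have hS : S = 0 := by
      ext a y
      simp [h₁ a y id]
    subst hS
    simp

theorem complementary_blockF_blockF_transpose (m n : ℕ) :
    Complementary (blockF m) (blockK m) (blockF n)ᵀ (blockK n)ᵀ (fun _ b => (b : ℕ) = n - 1)
      (fun a _ => (a : ℕ) = 0) := by
  constructor
  · intro M N
    obtain ⟨M, hM⟩ := exists_nat_extension M
    obtain ⟨N, hN⟩ := exists_nat_extension N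
    obtain ⟨X, hX₀, hX⟩ := exists_downward_rec (m - 1) (0 : ℕ → ℝ)
      (fun a x b => (if 0 < b then M (a + 1) (b - 1) + x (b - 1) else 0) - N (a + 1) b)
    refine ⟨Matrix.of fun a b => M a b + X a b, Matrix.of fun a b => X a b, fun a b hb => ?_,
      fun a b ha => ?_⟩
    · rw [mul_blockF_transpose, blockF_mul, hM, dif_pos (by omega)]
      simp only [Matrix.of_apply]
      split_ifs with h
      · ring
      · have : (a : ℕ) = m - 1 := by omega
        rw [this, hX₀]
        simp
    · rw [mul_blockK_transpose, blockK_mul, hN, dif_pos (show 0 < (a : ℕ) by omega)]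
      obtain ⟨c, hc⟩ : ∃ c, (a : ℕ) = c + 1 := ⟨a - 1, by omega⟩
      simp only [Matrix.of_apply, hc, Nat.add_sub_cancel, hX c (by omega)]
      split_ifs <;> ring
  · intro S R h₁ h₂
    simp only [mul_blockF_transpose, blockF_mul, mul_blockK_transpose, blockK_mul] at h₁ h₂ ⊢
    have hS : ∀ a (b : Fin (n - 1)), S a b =
        if h : (a : ℕ) < m - 1 then R ⟨a, h⟩ ⟨b, by omega⟩ else 0 := by
      intro a b
      have e := h₁ a ⟨b, by omega⟩ (by simp; omega)
      rwa [dif_pos (by simp)] at e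
    have hR : ∀ k (a : Fin (m - 1)) b, (a : ℕ) + 1 + k = m - 1 → R a b = 0 := by
      intro k
      induction k with
      | zero =>
        intro a b ha
        have e := h₂ ⟨a + 1, by omega⟩ b (by simp)
        rw [dif_pos (show 0 < (a : ℕ) + 1 by omega)] at e
        refine e.symm.trans ?_
        split_ifs
        · rw [hS, dif_neg (by simp; omega)]
        · rfl
      | succ k ih =>
        intro a b ha
        have e := h₂ ⟨a + 1, by omega⟩ b (by simp)
        rw [dif_pos (show 0 < (a : ℕ) + 1 by omega)] at e
        refine e.symm.trans ?_
        split_ifs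
        · rw [hS, dif_pos (by simp; omega), ih _ _ (by simp; omega)]
        · rfl
    have hR' : R = 0 := by
      ext a y
      exact hR (m - 1 - 1 - a) a y (by omega)
    subst hR'
    have hS' : S = 0 := by
      ext a y
      simp [hS a y]
    subst hS'
    simp

theorem complementary_regular_blockF (n : ℕ) (C : Matrix κ κ ℝ) :
    Complementary 1 C (blockF n) (blockK n) (fun _ _ => False) (fun _ _ => False) := by
  refine ⟨fun M N => ?_, fun S R h₁ h₂ => ⟨fun x y => h₁ x y id, fun x y => h₂ x y id⟩⟩
  obtain ⟨M', hM⟩ := exists_row_extension Mᵀ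
  obtain ⟨N', hN⟩ := exists_row_extension Nᵀ
  replace hM : ∀ x b, M x b = M' b x := fun x b => hM b x
  replace hN : ∀ x b, N x b = N' b x := fun x b => hN b x
  obtain ⟨X, -, hX⟩ := exists_upward_rec (0 : κ → ℝ) (fun b x => C *ᵥ (x - M' b) + N' b)
  refine ⟨Matrix.of fun x b => X b x, Matrix.of fun x b => X b x - M' b x, fun x b _ => ?_,
    fun x b _ => ?_⟩
  · rw [mul_blockF, Matrix.one_mul, hM]
    simp
  · rw [mul_blockK, hN]
    simp [hX, Matrix.mul_apply, Matrix.mulVec, dotProduct]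

theorem complementary_blockF_transpose_blockF (m n : ℕ) :
    Complementary (blockF m)ᵀ (blockK m)ᵀ (blockF n) (blockK n) (fun _ _ => False)
      (fun _ _ => False) := by
  refine ⟨fun M N => ?_, fun S R h₁ h₂ => ⟨fun x y => h₁ x y id, fun x y => h₂ x y id⟩⟩
  obtain ⟨M, hM⟩ := exists_nat_extension M
  obtain ⟨N, hN⟩ := exists_nat_extension N
  obtain ⟨X, -, hX⟩ := exists_upward_rec (0 : ℕ → ℝ)
    (fun b x a => (if a + 1 < m - 1 then x (a + 1) - M (a + 1) b else 0) + N a b)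
  refine ⟨Matrix.of fun a b => X b a,
    Matrix.of fun a b => if (a : ℕ) < m - 1 then X b a - M a b else 0, fun a b _ => ?_,
    fun a b _ => ?_⟩
  · rw [mul_blockF, blockF_transpose_mul, hM]
    simp
  · rw [mul_blockK, blockK_transpose_mul, hN]
    simp [hX]

theorem complementary_regular_nilpotent {κ' : Type*} [Fintype κ'] [DecidableEq κ']
    (C : Matrix κ κ ℝ) {J : Matrix κ' κ' ℝ} {d : ℕ} (hJ : J ^ d = 0) :
    Complementary 1 C J 1 (fun _ _ => False) (fun _ _ => False) := by
  refine ⟨fun M N => ?_, fun S R h₁ h₂ => ⟨fun x y => h₁ x y id, fun x y => h₂ x y id⟩⟩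
  set W := N - C * M
  have hW : (∑ k ∈ Finset.range d, C ^ k * W * J ^ k) -
      C * (∑ k ∈ Finset.range d, C ^ k * W * J ^ k) * J = W := by
    rw [Matrix.mul_sum, Matrix.sum_mul]
    have : ∀ k, C * (C ^ k * W * J ^ k) * J = C ^ (k + 1) * W * J ^ (k + 1) := fun k => by
      rw [pow_succ' C, pow_succ J]
      simp only [Matrix.mul_assoc]
    simp only [this]
    rw [← Finset.sum_sub_distrib, Finset.sum_range_sub' (fun k => C ^ k * W * J ^ k), hJ]
    simp
  set S := ∑ k ∈ Finset.range d, C ^ k * W * J ^ k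
  refine ⟨S, S * J - M, fun x y _ => by simp, fun x y _ => ?_⟩
  rw [← Matrix.sub_apply]
  refine congrFun (congrFun ?_ x) y
  rw [Matrix.mul_one, Matrix.mul_sub, ← Matrix.mul_assoc]
  calc S - (C * S * J - C * M) = (S - C * S * J) + C * M := by abel
    _ = N := by rw [hW]; simp [W]

end KroneckerPairs

/-- The real Jordan block `J^ℝ_n(lam)`. -/
noncomputable def jordanBlock (lam : ℂ) (n : ℕ) : Matrix (Fin n) (Fin n) ℝ :=
  Matrix.of fun a b => realJordanEntry lam a b

/-- Extension by zero of a finite column vector to all natural indices. -/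
def zeroExtend {n : ℕ} (φ : Fin n → ℝ) (k : ℕ) : ℝ :=
  if h : k < n then φ ⟨k, h⟩ else 0

theorem zeroExtend_of_le {n k : ℕ} (φ : Fin n → ℝ) (h : n ≤ k) : zeroExtend φ k = 0 :=
  dif_neg (by omega)

@[simp]
theorem zeroExtend_val {n : ℕ} (φ : Fin n → ℝ) (k : Fin n) : zeroExtend φ k = φ k := by
  simp [zeroExtend]

theorem zeroExtend_injective {n : ℕ} : Function.Injective (zeroExtend (n := n)) :=
  fun φ ψ h => funext fun a => by simpa using congrFun h a

theorem zeroExtend_add {n : ℕ} (φ ψ : Fin n → ℝ) (k : ℕ) :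
    zeroExtend (φ + ψ) k = zeroExtend φ k + zeroExtend ψ k := by
  simp only [zeroExtend]
  split_ifs <;> simp

theorem zeroExtend_sub {n : ℕ} (φ ψ : Fin n → ℝ) (k : ℕ) :
    zeroExtend (φ - ψ) k = zeroExtend φ k - zeroExtend ψ k := by
  simp only [zeroExtend]
  split_ifs <;> simp

theorem zeroExtend_smul {n : ℕ} (c : ℝ) (φ : Fin n → ℝ) (k : ℕ) :
    zeroExtend (c • φ) k = c * zeroExtend φ k := by
  simp only [zeroExtend]
  split_ifs <;> simp

/-- The action of an infinite real Jordan block on sequences. -/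
noncomputable def jordanOp (lam : ℂ) (f : ℕ → ℝ) (a : ℕ) : ℝ :=
  if lam.im = 0 then lam.re * f a + f (a + 1)
  else if a % 2 = 0 then lam.re * f a + lam.im * f (a + 1) + f (a + 2)
  else lam.re * f a - lam.im * f (a - 1) + f (a + 2)

theorem sum_range_ite_mul_zeroExtend {n : ℕ} (φ : Fin n → ℝ) (c : ℕ) (x : ℝ) :
    ∑ b ∈ Finset.range n, (if b = c then x else 0) * zeroExtend φ b = x * zeroExtend φ c := by
  simp only [ite_mul, zero_mul, Finset.sum_ite_eq', Finset.mem_range]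
  split_ifs with h
  · rfl
  · rw [zeroExtend_of_le φ (by omega), mul_zero]

theorem algebraMap_mulVec {n : ℕ} (c : ℝ) (φ : Fin n → ℝ) :
    algebraMap ℝ (Matrix (Fin n) (Fin n) ℝ) c *ᵥ φ = c • φ := by
  rw [Algebra.algebraMap_eq_smul_one, Matrix.smul_mulVec, Matrix.one_mulVec]

section JordanBlock

variable {lam : ℂ} {n : ℕ}

theorem zeroExtend_jordanBlock_mulVec (hn : lam.im ≠ 0 → Even n) (φ : Fin n → ℝ) :
    zeroExtend (jordanBlock lam n *ᵥ φ) = jordanOp lam (zeroExtend φ) := by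
  funext a
  by_cases ha : a < n
  · have h₁ : zeroExtend (jordanBlock lam n *ᵥ φ) a =
        ∑ b ∈ Finset.range n, realJordanEntry lam a b * zeroExtend φ b := by
      rw [← Fin.sum_univ_eq_sum_range fun b => realJordanEntry lam a b * zeroExtend φ b]
      simp [zeroExtend, ha, Matrix.mulVec, dotProduct, jordanBlock]
    rw [h₁, jordanOp]
    split_ifs with him hpar
    · have : ∀ b, realJordanEntry lam a b =
          (if b = a then lam.re else 0) + (if b = a + 1 then 1 else 0) := fun b => by
        simp only [realJordanEntry, him, if_true]
        split_ifs <;> first | omega | simp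
      simp only [this, add_mul, Finset.sum_add_distrib, sum_range_ite_mul_zeroExtend, one_mul]
    · have : ∀ b, realJordanEntry lam a b = (if b = a then lam.re else 0) +
          (if b = a + 1 then lam.im else 0) + (if b = a + 2 then 1 else 0) := fun b => by
        simp only [realJordanEntry, him, if_false]
        split_ifs <;> first | omega | simp
      simp only [this, add_mul, Finset.sum_add_distrib, sum_range_ite_mul_zeroExtend, one_mul]
    · have : ∀ b, realJordanEntry lam a b = (if b = a then lam.re else 0) +
          (if b = a - 1 then -lam.im else 0) + (if b = a + 2 then 1 else 0) := fun b => by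
        simp only [realJordanEntry, him, if_false]
        split_ifs <;> first | omega | simp
      simp only [this, add_mul, Finset.sum_add_distrib, sum_range_ite_mul_zeroExtend, one_mul]
      ring
  · rw [zeroExtend_of_le _ (by omega), jordanOp]
    split_ifs with him hpar
    · simp [zeroExtend_of_le φ (show n ≤ a by omega), zeroExtend_of_le φ (show n ≤ a + 1 by omega)]
    · simp [zeroExtend_of_le φ (show n ≤ a by omega), zeroExtend_of_le φ (show n ≤ a + 1 by omega),
        zeroExtend_of_le φ (show n ≤ a + 2 by omega)]
    · obtain ⟨m, hm⟩ := hn him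
      simp [zeroExtend_of_le φ (show n ≤ a by omega), zeroExtend_of_le φ (show n ≤ a - 1 by omega),
        zeroExtend_of_le φ (show n ≤ a + 2 by omega)]

/-- The minimal real polynomial vanishing at `lam`. -/
noncomputable def realMinpoly (lam : ℂ) : Polynomial ℝ :=
  if lam.im = 0 then Polynomial.X - Polynomial.C lam.re
  else (Polynomial.X - Polynomial.C lam.re) ^ 2 + Polynomial.C (lam.im ^ 2)

theorem zeroExtend_realMinpoly_mulVec (hn : lam.im ≠ 0 → Even n) (φ : Fin n → ℝ) (a : ℕ) :
    zeroExtend (Polynomial.aeval (jordanBlock lam n) (realMinpoly lam) *ᵥ φ) a =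
      if lam.im = 0 then zeroExtend φ (a + 1)
      else if a % 2 = 0 then 2 * lam.im * zeroExtend φ (a + 3) + zeroExtend φ (a + 4)
      else -2 * lam.im * zeroExtend φ (a + 1) + zeroExtend φ (a + 4) := by
  have hT : ∀ (φ : Fin n → ℝ) (a : ℕ), zeroExtend ((jordanBlock lam n -
      algebraMap ℝ (Matrix (Fin n) (Fin n) ℝ) lam.re) *ᵥ φ) a =
      jordanOp lam (zeroExtend φ) a - lam.re * zeroExtend φ a := fun φ a => by
    rw [Matrix.sub_mulVec, zeroExtend_sub, zeroExtend_jordanBlock_mulVec hn,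
      algebraMap_mulVec, zeroExtend_smul]
  rw [realMinpoly]
  by_cases him : lam.im = 0
  · simp only [him, if_true, map_sub, Polynomial.aeval_X, Polynomial.aeval_C, hT, jordanOp]
    ring
  · simp only [him, if_false, map_sub, map_add, Polynomial.aeval_X, Polynomial.aeval_C, pow_two,
      map_mul, Matrix.add_mulVec, ← Matrix.mulVec_mulVec, zeroExtend_add, hT, algebraMap_mulVec, zeroExtend_smul]
    simp only [jordanOp, him, if_false, hT]
    rcases Nat.mod_two_eq_zero_or_one a with h | h
    · have h₁ : (a + 1) % 2 = 1 := by omega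
      have h₂ : (a + 2) % 2 = 0 := by omega
      simp only [h, h₁, h₂, if_true, one_ne_zero, if_false, Nat.add_sub_cancel]
      ring
    · obtain ⟨b, rfl⟩ : ∃ b, a = b + 1 := ⟨a - 1, by omega⟩
      have h₁ : b % 2 = 0 := by omega
      have h₂ : (b + 1 + 2) % 2 = 1 := by omega
      have h₃ : b + 1 + 2 - 1 = b + 1 + 1 := by omega
      simp only [h, h₁, h₂, h₃, if_true, one_ne_zero, if_false, Nat.add_sub_cancel]
      ring

theorem realMinpoly_pow_mulVec (hn : lam.im ≠ 0 → Even n) (k : ℕ) (φ : Fin n → ℝ)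
    (hφ : ∀ a, k ≤ a → zeroExtend φ a = 0) :
    Polynomial.aeval (jordanBlock lam n) (realMinpoly lam) ^ k *ᵥ φ = 0 := by
  induction k generalizing φ with
  | zero =>
    have : φ = 0 := funext fun a => by simpa using hφ a (Nat.zero_le _)
    simp [this]
  | succ k ih =>
    rw [pow_succ, ← Matrix.mulVec_mulVec]
    refine ih _ fun a ha => ?_
    rw [zeroExtend_realMinpoly_mulVec hn, hφ (a + 1) (by omega), hφ (a + 3) (by omega),
      hφ (a + 4) (by omega)]
    simp

theorem aeval_jordanBlock_realMinpoly_pow (hn : lam.im ≠ 0 → Even n) :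
    Polynomial.aeval (jordanBlock lam n) (realMinpoly lam ^ n) = 0 := by
  rw [map_pow]
  refine Matrix.ext_of_mulVec_single fun i => ?_
  rw [realMinpoly_pow_mulVec hn n _ fun a ha => zeroExtend_of_le _ ha, Matrix.zero_mulVec]

theorem jordanBlock_zero_pow (n : ℕ) : jordanBlock 0 n ^ n = 0 := by
  have := aeval_jordanBlock_realMinpoly_pow (lam := 0) (n := n) (by simp)
  simpa [realMinpoly] using this

/-- The zeroth coordinate functional is cyclic for a real Jordan block. -/
theorem eq_zero_of_mem_invariant (hn : lam.im ≠ 0 → Even n) {U : Submodule ℝ (Fin n → ℝ)}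
    (hU : ∀ φ ∈ U, jordanBlock lam n *ᵥ φ ∈ U) (h₀ : ∀ φ ∈ U, zeroExtend φ 0 = 0)
    {φ : Fin n → ℝ} (hφ : φ ∈ U) : φ = 0 := by
  have hT : ∀ φ ∈ U, (jordanBlock lam n -
      algebraMap ℝ (Matrix (Fin n) (Fin n) ℝ) lam.re) *ᵥ φ ∈ U := fun φ hφ => by
    rw [Matrix.sub_mulVec, algebraMap_mulVec]
    exact U.sub_mem (hU φ hφ) (U.smul_mem _ hφ)
  have hM : ∀ φ ∈ U,
      Polynomial.aeval (jordanBlock lam n) (realMinpoly lam) *ᵥ φ ∈ U := fun φ hφ => by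
    rw [realMinpoly]
    split_ifs
    · simpa using hT φ hφ
    · simp only [map_sub, map_add, map_mul, Polynomial.aeval_X, Polynomial.aeval_C, pow_two,
        Matrix.add_mulVec, ← Matrix.mulVec_mulVec, algebraMap_mulVec]
      exact U.add_mem (hT _ (hT φ hφ)) (U.smul_mem _ (U.smul_mem _ hφ))
  have main : ∀ k, ∀ φ ∈ U, (∀ a, k ≤ a → zeroExtend φ a = 0) → φ = 0 := by
    intro k
    induction k with
    | zero => exact fun φ _ h => funext fun a => by simpa using h a (Nat.zero_le _)
    | succ k ih =>
      intro φ hφ hk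
      have hz : Polynomial.aeval (jordanBlock lam n) (realMinpoly lam) *ᵥ φ = 0 := by
        refine ih _ (hM φ hφ) fun a ha => ?_
        rw [zeroExtend_realMinpoly_mulVec hn, hk (a + 1) (by omega), hk (a + 3) (by omega),
          hk (a + 4) (by omega)]
        simp
      have hz' : ∀ a, (if lam.im = 0 then zeroExtend φ (a + 1)
          else if a % 2 = 0 then 2 * lam.im * zeroExtend φ (a + 3) + zeroExtend φ (a + 4)
          else -2 * lam.im * zeroExtend φ (a + 1) + zeroExtend φ (a + 4)) = 0 := fun a => by
        rw [← zeroExtend_realMinpoly_mulVec hn, hz]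
        simp [zeroExtend]
      refine ih φ hφ fun a ha => ?_
      rcases ha.eq_or_lt with rfl | ha
      swap
      · exact hk a ha
      rcases Nat.eq_zero_or_pos k with rfl | hpos
      · exact h₀ φ hφ
      obtain ⟨c, rfl⟩ : ∃ c, k = c + 1 := ⟨k - 1, by omega⟩
      by_cases him : lam.im = 0
      · simpa [him] using hz' c
      · rcases Nat.mod_two_eq_zero_or_one c with h | h
        · rcases Nat.eq_zero_or_pos c with rfl | hc
          · have e := h₀ _ (hT φ hφ)
            rw [Matrix.sub_mulVec, zeroExtend_sub, zeroExtend_jordanBlock_mulVec hn,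
              algebraMap_mulVec, zeroExtend_smul] at e
            simpa [jordanOp, him, hk 2 le_rfl] using e
          · obtain ⟨e, rfl⟩ : ∃ e, c = e + 2 := ⟨c - 2, by omega⟩
            have := hz' e
            rw [if_neg him, if_pos (by omega), hk (e + 4) (by omega)] at this
            simpa [him] using this
        · have := hz' c
          rw [if_neg him, if_neg (by omega), hk (c + 4) (by omega)] at this
          simpa [him] using this
  exact main n φ hφ fun a ha => zeroExtend_of_le φ ha

theorem jordanBlock_transpose_submatrix_rev (hn : lam.im ≠ 0 → Even n) :
    (jordanBlock lam n)ᵀ.submatrix Fin.revPerm Fin.revPerm = jordanBlock lam n := by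
  ext a b
  simp only [jordanBlock, Matrix.submatrix_apply, Matrix.transpose_apply, Matrix.of_apply,
    Fin.revPerm_apply, Fin.val_rev]
  by_cases him : lam.im = 0
  · simp only [realJordanEntry, him, if_true]
    split_ifs <;> first | rfl | omega
  · obtain ⟨m, hm⟩ := hn him
    simp only [realJordanEntry, him, if_false]
    split_ifs <;> first | rfl | omega

end JordanBlock

section Sylvester

variable {m n : ℕ}

/-- The Sylvester operator `S ↦ S J' - J S`. -/
def sylvester (J : Matrix (Fin m) (Fin m) ℝ) (J' : Matrix (Fin n) (Fin n) ℝ) :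
    Matrix (Fin m) (Fin n) ℝ →ₗ[ℝ] Matrix (Fin m) (Fin n) ℝ where
  toFun S := S * J' - J * S
  map_add' S T := by rw [Matrix.add_mul, Matrix.mul_add]; abel
  map_smul' c S := by simp [smul_sub]

/-- A complement for the Sylvester operator yields one for a pair of regular blocks. -/
theorem complementary_of_sylvester {J : Matrix (Fin m) (Fin m) ℝ} {J' : Matrix (Fin n) (Fin n) ℝ}
    {Q : Fin m → Fin n → Prop}
    (hex : ∀ N : Matrix (Fin m) (Fin n) ℝ, ∃ S, ∀ a b, ¬ Q a b → sylvester J J' S a b = N a b)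
    (huniq : ∀ S, (∀ a b, ¬ Q a b → sylvester J J' S a b = 0) → sylvester J J' S = 0) :
    Complementary 1 J 1 J' (fun _ _ => False) Q := by
  constructor
  · intro M N
    obtain ⟨S, hS⟩ := hex (N - J * M)
    refine ⟨S, S - M, fun x y _ => by simp, fun x y hQ => ?_⟩
    have := hS x y hQ
    simp only [sylvester, LinearMap.coe_mk, AddHom.coe_mk, Matrix.sub_apply] at this
    rw [Matrix.mul_sub, Matrix.sub_apply]
    linarith
  · intro S R h₁ h₂
    obtain rfl : S = R := by
      ext x y
      simpa using h₁ x y id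
    refine ⟨fun x y => h₁ x y id, fun x y => ?_⟩
    have := congrFun (congrFun (huniq S fun a b hQ => by simp [sylvester, h₂ a b hQ]) x) y
    exact sub_eq_zero.1 this

theorem sylvester_injective {J : Matrix (Fin m) (Fin m) ℝ} {J' : Matrix (Fin n) (Fin n) ℝ}
    {f g : Polynomial ℝ} (hf : Polynomial.aeval J f = 0) (hg : Polynomial.aeval J' g = 0)
    (hfg : IsCoprime f g) : Function.Injective (sylvester J J') := by
  refine (injective_iff_map_eq_zero _).2 fun S hS => ?_
  replace hS : S * J' = J * S := sub_eq_zero.1 hS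
  have key : ∀ h : Polynomial ℝ, S * Polynomial.aeval J' h = Polynomial.aeval J h * S := by
    intro h
    induction h using Polynomial.induction_on' with
    | add h₁ h₂ ih₁ ih₂ => rw [map_add, map_add, Matrix.mul_add, Matrix.add_mul, ih₁, ih₂]
    | monomial k c =>
      simp only [Polynomial.aeval_monomial, Algebra.algebraMap_eq_smul_one, smul_mul_assoc,
        one_mul, Matrix.mul_smul, Matrix.smul_mul]
      congr 1
      induction k with
      | zero => simp
      | succ k ih => rw [pow_succ, ← Matrix.mul_assoc, ih, Matrix.mul_assoc, hS, pow_succ,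
          Matrix.mul_assoc]
  obtain ⟨u, v, huv⟩ := hfg
  have h := key (u * f + v * g)
  have h' := key (u * f)
  rw [map_mul _ _ f, map_mul _ _ f, hf, mul_zero, Matrix.zero_mul] at h'
  rw [map_add, map_mul _ v, hg, mul_zero, add_zero, map_mul, h', huv, map_one,
    Matrix.one_mul] at h
  exact h.symm

end Sylvester
theorem re_eq_and_sq_im_eq_of_aeval_realMinpoly {lam z : ℂ}
    (h : Polynomial.aeval z (realMinpoly lam) = 0) : z.re = lam.re ∧ z.im ^ 2 = lam.im ^ 2 := by
  rw [realMinpoly] at h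
  split_ifs at h with him
  · simp only [map_sub, Polynomial.aeval_X, Polynomial.aeval_C, Complex.coe_algebraMap] at h
    rw [sub_eq_zero.1 h, him]
    simp
  · simp only [map_sub, map_add, map_pow, Polynomial.aeval_X, Polynomial.aeval_C,
      Complex.coe_algebraMap] at h
    have hre := congrArg Complex.re h
    have him' := congrArg Complex.im h
    simp [pow_two] at hre him'
    have hpos : 0 < lam.im * lam.im := mul_self_pos.2 him
    have h₀ : (z.re - lam.re) * z.im = 0 := by linarith
    rcases mul_eq_zero.1 h₀ with h₁ | h₁
    · refine ⟨by linarith, ?_⟩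
      rw [h₁] at hre
      nlinarith
    · rw [h₁] at hre
      nlinarith [mul_self_nonneg (z.re - lam.re)]

theorem isCoprime_realMinpoly {lam mu : ℂ} (h : lam ≠ mu) (hl : 0 ≤ lam.im) (hm : 0 ≤ mu.im) :
    IsCoprime (realMinpoly lam) (realMinpoly mu) := by
  refine (Polynomial.isCoprime_iff_aeval_ne_zero_of_isAlgClosed ℝ ℂ _ _).2 fun z => ?_
  by_contra! hz
  obtain ⟨h₁, h₂⟩ := re_eq_and_sq_im_eq_of_aeval_realMinpoly hz.1
  obtain ⟨h₃, h₄⟩ := re_eq_and_sq_im_eq_of_aeval_realMinpoly hz.2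
  refine h (Complex.ext (h₁.symm.trans h₃) ?_)
  exact (pow_left_inj₀ hl hm two_ne_zero).1 (h₂.symm.trans h₄)

theorem complementary_jordanBlock_of_ne {lam mu : ℂ} {m n : ℕ} (h : lam ≠ mu) (hl : 0 ≤ lam.im)
    (hm : 0 ≤ mu.im) (hlm : lam.im ≠ 0 → Even m) (hmn : mu.im ≠ 0 → Even n) :
    Complementary 1 (jordanBlock lam m) 1 (jordanBlock mu n) (fun _ _ => False)
      (fun _ _ => False) := by
  have hinj := sylvester_injective (aeval_jordanBlock_realMinpoly_pow hlm)
    (aeval_jordanBlock_realMinpoly_pow hmn) (isCoprime_realMinpoly h hl hm).pow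
  refine complementary_of_sylvester (fun N => ?_) fun S hS => Matrix.ext fun a b => hS a b id
  obtain ⟨S, hS⟩ := LinearMap.injective_iff_surjective.1 hinj N
  exact ⟨S, fun a b _ => by rw [hS]⟩

theorem trace_mul_sylvester {m n : ℕ} {J : Matrix (Fin m) (Fin m) ℝ}
    {J' : Matrix (Fin n) (Fin n) ℝ} (Y : Matrix (Fin n) (Fin m) ℝ) (S : Matrix (Fin m) (Fin n) ℝ) :
    (Y * sylvester J J' S).trace = (J' * Y * S).trace - (Y * J * S).trace := by
  change (Y * (S * J' - J * S)).trace = _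
  rw [Matrix.mul_sub, Matrix.trace_sub, ← Matrix.mul_assoc, Matrix.trace_mul_cycle,
    ← Matrix.mul_assoc]

theorem sylvester_jordanBlock_sup_eq_top {lam : ℂ} {m n : ℕ} (hn : lam.im ≠ 0 → Even n)
    {J : Matrix (Fin m) (Fin m) ℝ} {W : Submodule ℝ (Matrix (Fin m) (Fin n) ℝ)}
    (hW : LinearMap.range (sylvester J (jordanBlock lam n)) ≤ W)
    (hW₀ : ∀ a (b : Fin n), (b : ℕ) = 0 → Matrix.single a b 1 ∈ W) : W = ⊤ := by
  by_contra hne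
  obtain ⟨f, hf, hker⟩ := W.exists_le_ker_of_lt_top (lt_top_iff_ne_top.2 hne)
  obtain ⟨Y, hY⟩ : ∃ Y : Matrix (Fin n) (Fin m) ℝ, ∀ b a, Y b a = f (Matrix.single a b 1) :=
    ⟨Matrix.of fun b a => f (Matrix.single a b 1), fun _ _ => rfl⟩
  have hfY : ∀ N, f N = (Y * N).trace := by
    intro N
    conv_lhs => rw [Matrix.matrix_eq_sum_single N]
    simp only [map_sum, Matrix.trace, Matrix.diag_apply, Matrix.mul_apply]
    rw [Finset.sum_comm]
    refine Finset.sum_congr rfl fun b _ => Finset.sum_congr rfl fun a _ => ?_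
    have : Matrix.single a b (N a b) = N a b • Matrix.single a b (1 : ℝ) := by simp
    rw [this, map_smul, hY, smul_eq_mul, mul_comm]
  have hcomm : jordanBlock lam n * Y = Y * J := by
    rw [Matrix.ext_iff_trace_mul_right]
    intro S
    have : f (sylvester J (jordanBlock lam n) S) = 0 := hker (hW ⟨S, rfl⟩)
    rw [hfY, trace_mul_sylvester] at this
    exact sub_eq_zero.1 this
  have hY₀ : Y = 0 := by
    refine Matrix.ext_of_mulVec_single fun i => ?_
    rw [Matrix.zero_mulVec]
    refine eq_zero_of_mem_invariant hn (U := LinearMap.range Y.mulVecLin) ?_ ?_ ⟨_, rfl⟩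
    · rintro _ ⟨v, rfl⟩
      refine ⟨J *ᵥ v, ?_⟩
      simp only [Matrix.mulVecLin_apply, Matrix.mulVec_mulVec, hcomm]
    · rintro _ ⟨v, rfl⟩
      rw [zeroExtend]
      split_ifs with h
      · rw [Matrix.mulVecLin_apply, Matrix.mulVec]
        refine Finset.sum_eq_zero fun a _ => ?_
        have hYa : Y ⟨0, h⟩ a = 0 := (hY _ _).trans (hker (hW₀ a ⟨0, h⟩ rfl))
        change Y ⟨0, h⟩ a * v a = 0
        rw [hYa, zero_mul]
      · rfl
  exact hf (LinearMap.ext fun N => by simp [hfY, hY₀])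

theorem complementary_jordanBlock_of_le {lam : ℂ} {m n : ℕ} (hm : lam.im ≠ 0 → Even m)
    (hn : lam.im ≠ 0 → Even n) (hmn : m ≤ n) :
    Complementary 1 (jordanBlock lam m) 1 (jordanBlock lam n) (fun _ _ => False)
      (fun _ b => (b : ℕ) = 0) := by
  refine complementary_of_sylvester (fun N => ?_) fun S hS => ?_
  · let E : Submodule ℝ (Matrix (Fin m) (Fin n) ℝ) :=
      { carrier := {Q | ∀ a (b : Fin n), (b : ℕ) ≠ 0 → Q a b = 0}
        add_mem' := fun hA hB a b h => by simp [hA a b h, hB a b h]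
        zero_mem' := fun _ _ _ => rfl
        smul_mem' := fun c A hA a b h => by simp [hA a b h] }
    have htop : LinearMap.range (sylvester (jordanBlock lam m) (jordanBlock lam n)) ⊔ E = ⊤ := by
      refine sylvester_jordanBlock_sup_eq_top hn le_sup_left fun a b hb => ?_
      refine Submodule.mem_sup_right fun a' b' hb' => ?_
      refine Matrix.single_apply_of_ne _ _ _ _ _ ?_
      rintro ⟨-, rfl⟩
      exact hb' hb
    obtain ⟨_, ⟨S, rfl⟩, Q, hQ, hSQ⟩ := Submodule.mem_sup.1 (htop ▸ Submodule.mem_top (x := N))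
    refine ⟨S, fun a b hb => ?_⟩
    rw [← hSQ, Matrix.add_apply, hQ a b hb, add_zero]
  · ext x y
    by_cases hy : (y : ℕ) = 0
    swap
    · exact hS x y hy
    set Q := sylvester (jordanBlock lam m) (jordanBlock lam n) S with hQ
    obtain ⟨X, hX⟩ : ∃ X : Matrix (Fin n) (Fin m) ℝ,
        ∀ v, zeroExtend (X *ᵥ v) = zeroExtend v := by
      refine ⟨Matrix.of fun b a => if (a : ℕ) = b then 1 else 0, fun v => funext fun k => ?_⟩
      by_cases hk : k < n
      · by_cases hk' : k < m
        · simp only [zeroExtend, hk, hk', dif_pos, Matrix.mulVec, dotProduct, Matrix.of_apply]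
          rw [Finset.sum_eq_single ⟨k, hk'⟩]
          · simp
          · intro a _ ha
            have : (a : ℕ) ≠ k := fun h => ha (Fin.ext h)
            simp [this]
          · simp
        · rw [zeroExtend_of_le v (by omega), zeroExtend, dif_pos hk, Matrix.mulVec]
          refine Finset.sum_eq_zero fun a _ => ?_
          have : (a : ℕ) ≠ k := by omega
          simp [this]
      · rw [zeroExtend_of_le v (by omega), zeroExtend_of_le _ (by omega)]
    have hcomm : jordanBlock lam n * X = X * jordanBlock lam m := by
      refine Matrix.ext_of_mulVec_single fun i => zeroExtend_injective ?_
      rw [← Matrix.mulVec_mulVec, ← Matrix.mulVec_mulVec, zeroExtend_jordanBlock_mulVec hn, hX, hX,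
        zeroExtend_jordanBlock_mulVec hm]
    let U : Submodule ℝ (Fin n → ℝ) :=
      { carrier := {φ | ∀ k : ℕ, (jordanBlock lam n ^ k *ᵥ φ) y = 0}
        add_mem' := fun hA hB k => by simp [Matrix.mulVec_add, hA k, hB k]
        zero_mem' := fun _ => by simp
        smul_mem' := fun c A hA k => by simp [Matrix.mulVec_smul, hA k] }
    have hmem : X *ᵥ (fun a => Q a y) ∈ U := by
      intro k
      have htr := trace_mul_sylvester (J := jordanBlock lam m) (J' := jordanBlock lam n)
        (jordanBlock lam n ^ k * X) S
      rw [← Matrix.mul_assoc, ← pow_succ', pow_succ, Matrix.mul_assoc _ _ X, hcomm,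
        ← Matrix.mul_assoc, sub_self, ← hQ] at htr
      rw [Matrix.mulVec_mulVec, ← htr, Matrix.trace_mul_comm, Matrix.trace]
      change ∑ a, (jordanBlock lam n ^ k * X) y a * Q a y =
        ∑ a, (Q * (jordanBlock lam n ^ k * X)) a a
      refine Finset.sum_congr rfl fun a _ => ?_
      rw [Matrix.mul_apply (M := Q), Finset.sum_eq_single y, mul_comm]
      · intro b _ hb
        rw [hS a b fun h => hb (Fin.ext (h.trans hy.symm)), zero_mul]
      · simp
    have h0 := eq_zero_of_mem_invariant hn (U := U) (fun φ hφ k => by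
      rw [Matrix.mulVec_mulVec, ← pow_succ]
      exact hφ (k + 1)) (fun φ hφ => by
      have := hφ 0
      rw [pow_zero, Matrix.one_mulVec, ← zeroExtend_val φ y, hy] at this
      exact this) hmem
    have h1 := congrFun (hX fun a => Q a y) x
    rw [h0, zeroExtend_val] at h1
    simpa [zeroExtend] using h1.symm

theorem complementary_jordanBlock {lam : ℂ} {m n : ℕ} (hm : lam.im ≠ 0 → Even m)
    (hn : lam.im ≠ 0 → Even n) :
    Complementary 1 (jordanBlock lam m) 1 (jordanBlock lam n) (fun _ _ => False)
      (fun a b => (m ≤ n ∧ (b : ℕ) = 0) ∨ (n < m ∧ (a : ℕ) = m - 1)) := by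
  rcases le_or_gt m n with h | h
  · refine (complementary_jordanBlock_of_le hm hn h).congr_supp (fun _ _ => Iff.rfl) fun a b => ?_
    omega
  · have := (complementary_jordanBlock_of_le hn hm h.le).transpose.submatrix
      Fin.revPerm Fin.revPerm Fin.revPerm Fin.revPerm
    rw [jordanBlock_transpose_submatrix_rev hm, jordanBlock_transpose_submatrix_rev hn,
      Matrix.transpose_one, Matrix.transpose_one, Matrix.submatrix_one_equiv,
      Matrix.submatrix_one_equiv] at this
    refine this.congr_supp (fun _ _ => Iff.rfl) fun a b => ?_
    simp only [Fin.revPerm_apply, Fin.val_rev]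
    omega

section Assembly

variable {κ : Type*} [Fintype κ] [DecidableEq κ]

theorem complementary_regular_blockF_transpose (n : ℕ) (C : Matrix κ κ ℝ) :
    Complementary 1 C (blockF n)ᵀ (blockK n)ᵀ (fun _ _ => False) (fun _ b => (b : ℕ) = 0) := by
  simpa using (complementary_blockF_regular n Cᵀ).transpose

theorem complementary_blockF_transpose_regular (n : ℕ) (C : Matrix κ κ ℝ) :
    Complementary (blockF n)ᵀ (blockK n)ᵀ 1 C (fun _ _ => False) (fun _ _ => False) := by
  simpa using (complementary_regular_blockF n Cᵀ).transpose

theorem complementary_blockF_singular (m : ℕ) (J : Matrix κ κ ℝ) :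
    Complementary (blockF m) (blockK m) J 1 (fun a _ => (a : ℕ) = m - 1) (fun _ _ => False) := by
  have := (complementary_blockF_regular m J).swap.submatrix Fin.revPerm Fin.revPerm
    (Equiv.refl κ) (Equiv.refl κ)
  rw [blockF_submatrix_rev, blockK_submatrix_rev] at this
  refine this.congr_supp (fun a _ => ?_) fun _ _ => Iff.rfl
  simp only [Fin.revPerm_apply, Fin.val_rev]
  omega

theorem complementary_singular_blockF (n : ℕ) (J : Matrix κ κ ℝ) :
    Complementary J 1 (blockF n) (blockK n) (fun _ _ => False) (fun _ _ => False) := by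
  have := (complementary_regular_blockF n J).swap.submatrix (Equiv.refl κ) (Equiv.refl κ)
    Fin.revPerm Fin.revPerm
  rwa [blockF_submatrix_rev, blockK_submatrix_rev] at this

theorem complementary_singular_blockF_transpose (n : ℕ) (J : Matrix κ κ ℝ) :
    Complementary J 1 (blockF n)ᵀ (blockK n)ᵀ (fun _ b => (b : ℕ) = n - 1)
      (fun _ _ => False) := by
  simpa using (complementary_blockF_singular n Jᵀ).transpose

theorem complementary_blockF_transpose_singular (n : ℕ) (J : Matrix κ κ ℝ) :
    Complementary (blockF n)ᵀ (blockK n)ᵀ J 1 (fun _ _ => False) (fun _ _ => False) := by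
  simpa using (complementary_singular_blockF n Jᵀ).transpose

theorem complementary_nilpotent_regular {κ' : Type*} [Fintype κ'] [DecidableEq κ']
    {J : Matrix κ' κ' ℝ} {d : ℕ} (hJ : J ^ d = 0) (C : Matrix κ κ ℝ) :
    Complementary J 1 1 C (fun _ _ => False) (fun _ _ => False) := by
  have hJ' : Jᵀ ^ d = 0 := by rw [← Matrix.transpose_pow, hJ, Matrix.transpose_zero]
  simpa using (complementary_regular_nilpotent Cᵀ hJ').transpose

end Assembly

/-- The diagonal blocks of the Kronecker pencil. -/
abbrev Block := Fin l ⊕ ((Σ i : Fin s, Fin (tC i)) ⊕ (Fin u ⊕ Fin r))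

/-- The number of rows of a diagonal block. -/
abbrev rowSize : Block l r s tC u → ℕ
  | Sum.inl i => p i
  | Sum.inr (Sum.inl c) => szC c.1 c.2
  | Sum.inr (Sum.inr (Sum.inl k)) => dsz k
  | Sum.inr (Sum.inr (Sum.inr j)) => q j - 1

/-- The number of columns of a diagonal block. -/
abbrev colSize : Block l r s tC u → ℕ
  | Sum.inl i => p i - 1
  | Sum.inr (Sum.inl c) => szC c.1 c.2
  | Sum.inr (Sum.inr (Sum.inl k)) => dsz k
  | Sum.inr (Sum.inr (Sum.inr j)) => q j

/-- Rows grouped by diagonal blocks. -/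
def rowEquiv : (Σ t, Fin (rowSize l r p q s tC szC u dsz t)) ≃ Row l r p q s tC szC u dsz where
  toFun
    | ⟨Sum.inl i, a⟩ => Sum.inl ⟨i, a⟩
    | ⟨Sum.inr (Sum.inl c), a⟩ => Sum.inr (Sum.inl ⟨c.1, c.2, a⟩)
    | ⟨Sum.inr (Sum.inr (Sum.inl k)), a⟩ => Sum.inr (Sum.inr (Sum.inl ⟨k, a⟩))
    | ⟨Sum.inr (Sum.inr (Sum.inr j)), a⟩ => Sum.inr (Sum.inr (Sum.inr ⟨j, a⟩))
  invFun
    | Sum.inl ⟨i, a⟩ => ⟨Sum.inl i, a⟩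
    | Sum.inr (Sum.inl ⟨i, j, a⟩) => ⟨Sum.inr (Sum.inl ⟨i, j⟩), a⟩
    | Sum.inr (Sum.inr (Sum.inl ⟨k, a⟩)) => ⟨Sum.inr (Sum.inr (Sum.inl k)), a⟩
    | Sum.inr (Sum.inr (Sum.inr ⟨j, a⟩)) => ⟨Sum.inr (Sum.inr (Sum.inr j)), a⟩
  left_inv := by rintro ⟨_ | _ | _ | _, _⟩ <;> rfl
  right_inv := by rintro (_ | _ | _ | _) <;> rfl

/-- Columns grouped by diagonal blocks. -/
def colEquiv : (Σ t, Fin (colSize l r p q s tC szC u dsz t)) ≃ Col l r p q s tC szC u dsz where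
  toFun
    | ⟨Sum.inl i, a⟩ => Sum.inl ⟨i, a⟩
    | ⟨Sum.inr (Sum.inl c), a⟩ => Sum.inr (Sum.inl ⟨c.1, c.2, a⟩)
    | ⟨Sum.inr (Sum.inr (Sum.inl k)), a⟩ => Sum.inr (Sum.inr (Sum.inl ⟨k, a⟩))
    | ⟨Sum.inr (Sum.inr (Sum.inr j)), a⟩ => Sum.inr (Sum.inr (Sum.inr ⟨j, a⟩))
  invFun
    | Sum.inl ⟨i, a⟩ => ⟨Sum.inl i, a⟩
    | Sum.inr (Sum.inl ⟨i, j, a⟩) => ⟨Sum.inr (Sum.inl ⟨i, j⟩), a⟩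
    | Sum.inr (Sum.inr (Sum.inl ⟨k, a⟩)) => ⟨Sum.inr (Sum.inr (Sum.inl k)), a⟩
    | Sum.inr (Sum.inr (Sum.inr ⟨j, a⟩)) => ⟨Sum.inr (Sum.inr (Sum.inr j)), a⟩
  left_inv := by rintro ⟨_ | _ | _ | _, _⟩ <;> rfl
  right_inv := by rintro (_ | _ | _ | _) <;> rfl

/-- The diagonal blocks of the first matrix. -/
noncomputable def blockA : ∀ t : Block l r s tC u, Matrix (Fin (rowSize l r p q s tC szC u dsz t))
    (Fin (colSize l r p q s tC szC u dsz t)) ℝ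
  | Sum.inl i => blockF (p i)
  | Sum.inr (Sum.inl c) => (1 : Matrix (Fin (szC c.1 c.2)) (Fin (szC c.1 c.2)) ℝ)
  | Sum.inr (Sum.inr (Sum.inl k)) => jordanBlock 0 (dsz k)
  | Sum.inr (Sum.inr (Sum.inr j)) => (blockF (q j))ᵀ

/-- The diagonal blocks of the second matrix. -/
noncomputable def blockB : ∀ t : Block l r s tC u, Matrix (Fin (rowSize l r p q s tC szC u dsz t))
    (Fin (colSize l r p q s tC szC u dsz t)) ℝ
  | Sum.inl i => blockK (p i)
  | Sum.inr (Sum.inl c) => jordanBlock (lamC c.1) (szC c.1 c.2)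
  | Sum.inr (Sum.inr (Sum.inl k)) => (1 : Matrix (Fin (dsz k)) (Fin (dsz k)) ℝ)
  | Sum.inr (Sum.inr (Sum.inr j)) => (blockK (q j))ᵀ

theorem A_apply_same (t : Block l r s tC u) (a b) :
    A l r p q s tC szC u dsz (rowEquiv l r p q s tC szC u dsz ⟨t, a⟩)
      (colEquiv l r p q s tC szC u dsz ⟨t, b⟩) = blockA l r p q s tC szC u dsz t a b := by
  rcases t with i | c | k | j
  · simp [A, rowEquiv, colEquiv, blockA, blockF]
  · simp [A, rowEquiv, colEquiv, blockA, Matrix.one_apply]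
  · simp only [A, rowEquiv, colEquiv, blockA, jordanBlock, realJordanEntry, Equiv.coe_fn_mk,
      Matrix.of_apply, Complex.zero_im, Complex.zero_re]
    split_ifs <;> simp_all
  · simp [A, rowEquiv, colEquiv, blockA, blockF, eq_comm]

theorem A_apply_of_ne {t t' : Block l r s tC u} (h : t ≠ t') (a b) :
    A l r p q s tC szC u dsz (rowEquiv l r p q s tC szC u dsz ⟨t, a⟩)
      (colEquiv l r p q s tC szC u dsz ⟨t', b⟩) = 0 := by
  rcases t with i | ⟨i, j⟩ | k | j <;> rcases t' with i' | ⟨i', j'⟩ | k' | j' <;> try rfl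
  · simp_all [A, rowEquiv, colEquiv]
  · simp only [A, rowEquiv, colEquiv, Equiv.coe_fn_mk, Matrix.of_apply]
    refine if_neg fun hc => h ?_
    cases hc
    rfl
  · simp_all [A, rowEquiv, colEquiv]
  · simp_all [A, rowEquiv, colEquiv]

theorem B_apply_same (t : Block l r s tC u) (a b) :
    B l r p q s lamC tC szC u dsz (rowEquiv l r p q s tC szC u dsz ⟨t, a⟩)
      (colEquiv l r p q s tC szC u dsz ⟨t, b⟩) = blockB l r p q s lamC tC szC u dsz t a b := by
  rcases t with i | c | k | j
  · simp [B, rowEquiv, colEquiv, blockB, blockK]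
  · simp [B, rowEquiv, colEquiv, blockB, jordanBlock]
  · simp [B, rowEquiv, colEquiv, blockB, Matrix.one_apply]
  · simp [B, rowEquiv, colEquiv, blockB, blockK]

theorem B_apply_of_ne {t t' : Block l r s tC u} (h : t ≠ t') (a b) :
    B l r p q s lamC tC szC u dsz (rowEquiv l r p q s tC szC u dsz ⟨t, a⟩)
      (colEquiv l r p q s tC szC u dsz ⟨t', b⟩) = 0 := by
  rcases t with i | ⟨i, j⟩ | k | j <;> rcases t' with i' | ⟨i', j'⟩ | k' | j' <;> try rfl
  · simp_all [B, rowEquiv, colEquiv]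
  · simp only [B, rowEquiv, colEquiv, Equiv.coe_fn_mk, Matrix.of_apply]
    refine if_neg fun ⟨hi, hj⟩ => h ?_
    obtain rfl := hi
    obtain rfl := Fin.ext hj
    rfl
  · simp only [B, rowEquiv, colEquiv, Equiv.coe_fn_mk, Matrix.of_apply]
    refine if_neg fun hc => h ?_
    cases hc
    rfl
  · simp_all [B, rowEquiv, colEquiv]

theorem complementary_kronecker
    (hpmono : ∀ i i' : Fin l, i ≤ i' → p i ≤ p i')
    (hqmono : ∀ j j' : Fin r, j ≤ j' → q j' ≤ q j)
    (hlam : Function.Injective lamC) (him : ∀ i, 0 ≤ (lamC i).im)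
    (heven : ∀ (i : Fin s) (j : Fin (tC i)), 0 < (lamC i).im → Even (szC i j)) :
    Complementary (A l r p q s tC szC u dsz) (B l r p q s lamC tC szC u dsz)
      (A l r p q s tC szC u dsz) (B l r p q s lamC tC szC u dsz)
      (PSupp l r p q s tC szC u dsz) (QSupp l r p q s tC szC u dsz) := by
  set e := rowEquiv l r p q s tC szC u dsz with he
  set f := colEquiv l r p q s tC szC u dsz with hf
  have heven' : ∀ (i : Fin s) (j : Fin (tC i)), (lamC i).im ≠ 0 → Even (szC i j) :=
    fun i j h => heven i j ((him i).lt_of_ne' h)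
  suffices h : Complementary ((A l r p q s tC szC u dsz).submatrix e f)
      ((B l r p q s lamC tC szC u dsz).submatrix e f)
      ((A l r p q s tC szC u dsz).submatrix e f) ((B l r p q s lamC tC szC u dsz).submatrix e f)
      (fun x y => PSupp l r p q s tC szC u dsz (e x) (f y))
      (fun x y => QSupp l r p q s tC szC u dsz (e x) (f y)) by
    simpa using h.submatrix e.symm f.symm e.symm f.symm
  refine Complementary.of_blocks
    (fun t t' a b h => A_apply_of_ne l r p q s tC szC u dsz h a b)
    (fun t t' a b h => B_apply_of_ne l r p q s lamC tC szC u dsz h a b) fun t t' => ?_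
  simp only [Matrix.submatrix_apply, he, hf, A_apply_same, B_apply_same]
  rcases t with i | ⟨i, j⟩ | k | j <;> rcases t' with i' | ⟨i', j'⟩ | k' | j'
  · refine (complementary_blockF_blockF (p i) (p i')).congr_supp (fun _ _ => Iff.rfl) fun a b => ?_
    refine ⟨And.right, fun h => ⟨?_, h⟩⟩
    by_contra hlt
    have := hpmono i' i (not_lt.1 hlt)
    omega
  · exact complementary_blockF_regular (p i) _
  · exact complementary_blockF_singular (p i) _
  · exact complementary_blockF_blockF_transpose (p i) (q j')
  · exact complementary_regular_blockF (p i') _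
  · by_cases h : i = i'
    · subst h
      refine (complementary_jordanBlock (heven' i j) (heven' i j')).congr_supp
        (fun _ _ => Iff.rfl) fun a b => ?_
      exact and_iff_right rfl
    · refine (complementary_jordanBlock_of_ne (hlam.ne h) (him i) (him i') (heven' i j)
        (heven' i' j')).congr_supp (fun _ _ => Iff.rfl) fun a b => ?_
      exact iff_false_intro fun hs => h hs.1
  · exact complementary_regular_nilpotent _ (jordanBlock_zero_pow (dsz k'))
  · exact complementary_regular_blockF_transpose (q j') _
  · exact complementary_singular_blockF (p i') _
  · exact complementary_nilpotent_regular (jordanBlock_zero_pow (dsz k)) _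
  · exact (complementary_jordanBlock (lam := 0) (by simp) (by simp)).swap
  · exact complementary_singular_blockF_transpose (q j') _
  · exact complementary_blockF_transpose_blockF (q j) (p i')
  · exact complementary_blockF_transpose_regular (q j) _
  · exact complementary_blockF_transpose_singular (q j) _
  · refine (complementary_blockF_blockF (q j') (q j)).transpose.congr_supp
      (fun _ _ => Iff.rfl) fun a b => ?_
    refine ⟨And.right, fun h => ⟨?_, h⟩⟩
    by_contra hlt
    have := hqmono j' j (not_lt.1 hlt)
    omega

/-- Theorem 3.1 of the paper over `ℝ`: the space of pairs is the internal direct sum of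
the coordinate subspace `𝒫` (supported on `PSupp`, `QSupp`) and the tangent space
`{(SA − AR, SB − BR)}`. -/
theorem simplest_miniversal_kronecker_real
    (hp1 : ∀ i, 1 ≤ p i) (hpmono : ∀ i i' : Fin l, i ≤ i' → p i ≤ p i')
    (hq1 : ∀ j, 1 ≤ q j) (hqmono : ∀ j j' : Fin r, j ≤ j' → q j' ≤ q j)
    (hlam : Function.Injective lamC) (him : ∀ i, 0 ≤ (lamC i).im)
    (heven : ∀ (i : Fin s) (j : Fin (tC i)), 0 < (lamC i).im → Even (szC i j))
    (hszC1 : ∀ i j, 1 ≤ szC i j)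
    (hszCmono : ∀ (i : Fin s) (j j' : Fin (tC i)), j ≤ j' → szC i j' ≤ szC i j)
    (hd1 : ∀ k, 1 ≤ dsz k) (hdmono : ∀ k k' : Fin u, k ≤ k' → dsz k' ≤ dsz k) :
    (∀ M N : Matrix (Row l r p q s tC szC u dsz) (Col l r p q s tC szC u dsz) ℝ,
      ∃ (P Q : Matrix (Row l r p q s tC szC u dsz) (Col l r p q s tC szC u dsz) ℝ)
        (S : Matrix (Row l r p q s tC szC u dsz) (Row l r p q s tC szC u dsz) ℝ)
        (R : Matrix (Col l r p q s tC szC u dsz) (Col l r p q s tC szC u dsz) ℝ),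
        (∀ x y, ¬ PSupp l r p q s tC szC u dsz x y → P x y = 0) ∧
        (∀ x y, ¬ QSupp l r p q s tC szC u dsz x y → Q x y = 0) ∧
        M = P + (S * A l r p q s tC szC u dsz - A l r p q s tC szC u dsz * R) ∧
        N = Q + (S * B l r p q s lamC tC szC u dsz - B l r p q s lamC tC szC u dsz * R)) ∧
    (∀ (P Q : Matrix (Row l r p q s tC szC u dsz) (Col l r p q s tC szC u dsz) ℝ)
        (S : Matrix (Row l r p q s tC szC u dsz) (Row l r p q s tC szC u dsz) ℝ)
        (R : Matrix (Col l r p q s tC szC u dsz) (Col l r p q s tC szC u dsz) ℝ),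
        (∀ x y, ¬ PSupp l r p q s tC szC u dsz x y → P x y = 0) →
        (∀ x y, ¬ QSupp l r p q s tC szC u dsz x y → Q x y = 0) →
        P + (S * A l r p q s tC szC u dsz - A l r p q s tC szC u dsz * R) = 0 →
        Q + (S * B l r p q s lamC tC szC u dsz - B l r p q s lamC tC szC u dsz * R) = 0 →
        P = 0 ∧ Q = 0 ∧
          S * A l r p q s tC szC u dsz - A l r p q s tC szC u dsz * R = 0 ∧
          S * B l r p q s lamC tC szC u dsz - B l r p q s lamC tC szC u dsz * R = 0) := by
  have h := complementary_kronecker l r p q s lamC tC szC u dsz hpmono hqmono hlam him heven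
  refine ⟨fun M N => ?_, fun P Q S R hP hQ h₁ h₂ => ?_⟩
  · obtain ⟨S, R, hS, hR⟩ := h.1 M N
    refine ⟨_, _, S, R, fun x y hx => ?_, fun x y hx => ?_, (sub_add_cancel M _).symm,
      (sub_add_cancel N _).symm⟩
    · rw [Matrix.sub_apply, Matrix.sub_apply, hS x y hx, sub_self]
    · rw [Matrix.sub_apply, Matrix.sub_apply, hR x y hx, sub_self]
  · obtain ⟨h₃, h₄⟩ := h.2 S R
      (fun x y hx => by
        have := congrFun (congrFun h₁ x) y
        rw [Matrix.add_apply, hP x y hx, zero_add] at this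
        exact sub_eq_zero.1 this)
      (fun x y hx => by
        have := congrFun (congrFun h₂ x) y
        rw [Matrix.add_apply, hQ x y hx, zero_add] at this
        exact sub_eq_zero.1 this)
    have hA := sub_eq_zero.2 (Matrix.ext h₃)
    have hB := sub_eq_zero.2 (Matrix.ext h₄)
    rw [hA, add_zero] at h₁
    rw [hB, add_zero] at h₂
    exact ⟨h₁, h₂, hA, hB⟩

end KroneckerReal
end

section
/- Let F be ℝ or ℂ and let 1 ≤ p ≤ q. For every pair of matrices M, N ∈ F^{p×(q−1)} there exist S ∈ F^{p×q}, R ∈ F^{(p−1)×(q−1)}, and a matrix Z ∈ F^{p×(q−1)} that is zero outside the first max(q−1−p, 0) entries of its first row, such that M + S F_q − F_p R = 0 and N + S K_q − K_p R = Z; moreover Z is uniquely determined by (M,N): if S', R', Z' also satisfy these conditions (with Z' of the same support form), then Z' = Z. -/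
open Matrix

/-- The `r × (r−1)` matrix `F_r` with `1` in positions `(i, i)` and `0` elsewhere. -/
def Fmat (F : Type*) [Zero F] [One F] (r : ℕ) : Matrix (Fin r) (Fin (r - 1)) F :=
  Matrix.of fun i j => if (i : ℕ) = (j : ℕ) then 1 else 0

/-- The `r × (r−1)` matrix `K_r` with `1` in positions `(i+1, i)` and `0` elsewhere. -/
def Kmat (F : Type*) [Zero F] [One F] (r : ℕ) : Matrix (Fin r) (Fin (r - 1)) F :=
  Matrix.of fun i j => if (i : ℕ) = (j : ℕ) + 1 then 1 else 0

/-- `Z` is zero outside the first `max (q − 1 − p) 0` entries of its first row. -/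
def IsZForm {F : Type*} [Zero F] {p q : ℕ} (Z : Matrix (Fin p) (Fin (q - 1)) F) : Prop :=
  ∀ (i : Fin p) (j : Fin (q - 1)), ¬((i : ℕ) = 0 ∧ (j : ℕ) < q - 1 - p) → Z i j = 0

theorem mul_Fmat_apply {F : Type*} [NonAssocSemiring F] {p q : ℕ} (S : Matrix (Fin p) (Fin q) F)
    (i : Fin p) (j : Fin (q - 1)) : (S * Fmat F q) i j = S i ⟨j, by omega⟩ := by
  rw [Matrix.mul_apply, Finset.sum_eq_single ⟨j, by omega⟩]
  · simp [Fmat]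
  · intro b _ hb
    simp [Fmat, Fin.ext_iff] at hb ⊢
    simp [hb]
  · simp

theorem mul_Kmat_apply {F : Type*} [NonAssocSemiring F] {p q : ℕ} (S : Matrix (Fin p) (Fin q) F)
    (i : Fin p) (j : Fin (q - 1)) : (S * Kmat F q) i j = S i ⟨j + 1, by omega⟩ := by
  rw [Matrix.mul_apply, Finset.sum_eq_single ⟨j + 1, by omega⟩]
  · simp [Kmat]
  · intro b _ hb
    simp [Kmat, Fin.ext_iff] at hb ⊢
    simp [hb]
  · simp

theorem Fmat_mul_apply {F : Type*} [NonAssocSemiring F] {p n : ℕ}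
    (R : Matrix (Fin (p - 1)) (Fin n) F) (i : Fin p) (j : Fin n) :
    (Fmat F p * R) i j = if h : (i : ℕ) < p - 1 then R ⟨i, h⟩ j else 0 := by
  rw [Matrix.mul_apply]
  split_ifs with h
  · rw [Finset.sum_eq_single ⟨i, h⟩]
    · simp [Fmat]
    · intro b _ hb
      have : (i : ℕ) ≠ b := fun e => hb (Fin.ext e.symm)
      simp [Fmat, this]
    · simp
  · refine Finset.sum_eq_zero fun b _ => ?_
    have : (i : ℕ) ≠ b := by omega
    simp [Fmat, this]

theorem Kmat_mul_apply {F : Type*} [NonAssocSemiring F] {p n : ℕ}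
    (R : Matrix (Fin (p - 1)) (Fin n) F) (i : Fin p) (j : Fin n) :
    (Kmat F p * R) i j = if h : 0 < (i : ℕ) then R ⟨i - 1, by omega⟩ j else 0 := by
  rw [Matrix.mul_apply]
  split_ifs with h
  · rw [Finset.sum_eq_single ⟨i - 1, by omega⟩]
    · have : (i : ℕ) = i - 1 + 1 := by omega
      simp [Kmat, ← this]
    · intro b _ hb
      have : (i : ℕ) ≠ b + 1 := fun e => hb (Fin.ext (by simp [e]))
      simp [Kmat, this]
    · simp
  · refine Finset.sum_eq_zero fun b _ => ?_
    have : (i : ℕ) ≠ b + 1 := by omega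
    simp [Kmat, this]

/-- An array on rows `0, …, m` with prescribed increments along diagonals: its last row can be
prescribed in the columns `j < n`, and its first row on the diagonals that do not meet these
positions. -/
theorem exists_diagonal_array {G : Type*} [AddCommGroup G] {m n : ℕ} (hmn : m ≤ n)
    (d : ℕ → ℕ → G) (b c : ℕ → G) :
    ∃ s : ℕ → ℕ → G, (∀ j < n, s m j = b j) ∧
      (∀ i < m, ∀ j, s (i + 1) (j + 1) = s i j + d i j) ∧
      ∀ j, n ≤ j + 1 + m → s 0 (j + 1) = c j := by
  refine ⟨fun i j => if j + (m - i) < n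
    then b (j + (m - i)) - ∑ t ∈ Finset.range (m - i), d (i + t) (j + t)
    else c (j - i - 1) + ∑ t ∈ Finset.range i, d t (j - i + t), ?_, ?_, ?_⟩
  · intro j hj
    simp [hj]
  · intro i hi j
    obtain ⟨k, rfl⟩ : ∃ k, m = i + 1 + k := ⟨m - (i + 1), by omega⟩
    have h1 : i + 1 + k - (i + 1) = k := by omega
    have h2 : i + 1 + k - i = k + 1 := by omega
    have h3 : j + 1 + k = j + (k + 1) := by omega
    simp only [h1, h2, h3]
    split_ifs with h
    · rw [Finset.sum_range_succ']
      simp only [add_zero, add_assoc, add_comm 1]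
      abel
    · have h4 : j + 1 - (i + 1) = j - i := by omega
      have h5 : j - i + i = j := by omega
      rw [h4, Finset.sum_range_succ, h5, add_assoc]
  · intro j hj
    have : ¬ j + 1 + m < n := by omega
    simp [this]

/-- The entries of `S` on the diagonals that meet the last row in its first `q - 1` columns are
determined by `M` and `N`; here `k` is the distance from the last row. -/
theorem eq_of_pencil_eq {F : Type*} [Ring F] {p q : ℕ}
    {M N : Matrix (Fin p) (Fin (q - 1)) F} {S S' : Matrix (Fin p) (Fin q) F}
    {R R' : Matrix (Fin (p - 1)) (Fin (q - 1)) F} {Z Z' : Matrix (Fin p) (Fin (q - 1)) F}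
    (hZ : IsZForm Z) (hZ' : IsZForm Z')
    (hM : M + S * Fmat F q - Fmat F p * R = 0) (hN : N + S * Kmat F q - Kmat F p * R = Z)
    (hM' : M + S' * Fmat F q - Fmat F p * R' = 0)
    (hN' : N + S' * Kmat F q - Kmat F p * R' = Z') (k : ℕ) :
    ∀ (i : Fin p) (j : Fin q), (i : ℕ) + k + 1 = p → (j : ℕ) + k < q - 1 → S i j = S' i j := by
  induction k with
  | zero =>
    intro i j hi hj
    have e := congrFun₂ (hM.trans hM'.symm) i ⟨j, hj⟩
    have h : ¬ (i : ℕ) < p - 1 := by omega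
    simpa [mul_Fmat_apply, Fmat_mul_apply, h] using e
  | succ k ih =>
    intro i j hi hj
    have hj' : (j : ℕ) < q - 1 := by omega
    have h : (i : ℕ) < p - 1 := by omega
    have hi' : (i : ℕ) + 1 < p := by omega
    have e := congrFun₂ (hM.trans hM'.symm) i ⟨j, hj'⟩
    have f := congrFun₂ hN ⟨i + 1, hi'⟩ ⟨j, hj'⟩
    have f' := congrFun₂ hN' ⟨i + 1, hi'⟩ ⟨j, hj'⟩
    rw [hZ _ _ (by simp)] at f
    rw [hZ' _ _ (by simp), ← f] at f'
    have g := ih ⟨i + 1, hi'⟩ ⟨j + 1, by omega⟩ (by simp; omega) (by simp; omega)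
    simp [mul_Kmat_apply, Kmat_mul_apply, g] at f'
    simpa [mul_Fmat_apply, Fmat_mul_apply, h, f'] using e

/-- Case 1 of the paper's Theorem 3.1: interaction of two Kronecker summands
`(F_p, K_p)` and `(F_q, K_q)` with `p ≤ q`. -/
theorem pencil_case1 (F : Type*) [RCLike F] (p q : ℕ) (hp : 1 ≤ p) (hpq : p ≤ q)
    (M N : Matrix (Fin p) (Fin (q - 1)) F) :
    (∃ (S : Matrix (Fin p) (Fin q) F) (R : Matrix (Fin (p - 1)) (Fin (q - 1)) F)
        (Z : Matrix (Fin p) (Fin (q - 1)) F), IsZForm Z ∧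
        M + S * Fmat F q - Fmat F p * R = 0 ∧
        N + S * Kmat F q - Kmat F p * R = Z) ∧
    (∀ (S S' : Matrix (Fin p) (Fin q) F) (R R' : Matrix (Fin (p - 1)) (Fin (q - 1)) F)
        (Z Z' : Matrix (Fin p) (Fin (q - 1)) F), IsZForm Z → IsZForm Z' →
        M + S * Fmat F q - Fmat F p * R = 0 →
        N + S * Kmat F q - Kmat F p * R = Z →
        M + S' * Fmat F q - Fmat F p * R' = 0 →
        N + S' * Kmat F q - Kmat F p * R' = Z' → Z = Z') := by
  constructor
  · let m : ℕ → ℕ → F := fun i j => if h : i < p ∧ j < q - 1 then M ⟨i, h.1⟩ ⟨j, h.2⟩ else 0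
    let n : ℕ → ℕ → F := fun i j => if h : i < p ∧ j < q - 1 then N ⟨i, h.1⟩ ⟨j, h.2⟩ else 0
    have hm : ∀ (i : Fin p) (j : Fin (q - 1)), M i j = m i j := fun i j => by simp [m]
    have hn : ∀ (i : Fin p) (j : Fin (q - 1)), N i j = n i j := fun i j => by simp [n]
    obtain ⟨s, hlast, hdiag, hfirst⟩ := exists_diagonal_array (show p - 1 ≤ q - 1 by omega)
      (fun i j => m i j - n (i + 1) j) (fun j => -m (p - 1) j) (fun j => -n 0 j)
    refine ⟨Matrix.of fun i j => s i j, Matrix.of fun i j => m i j + s i j, _, ?_, ?_, rfl⟩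
    · intro i j hij
      simp only [Matrix.sub_apply, Matrix.add_apply, mul_Kmat_apply, Kmat_mul_apply, hn,
        Matrix.of_apply]
      split_ifs with h
      · obtain ⟨k, hk⟩ : ∃ k, (i : ℕ) = k + 1 := ⟨i - 1, by omega⟩
        rw [hk, hdiag k (by omega), Nat.add_sub_cancel]
        abel
      · have hi : (i : ℕ) = 0 := by omega
        rw [hi, hfirst _ (by omega)]
        simp
    · ext i j
      simp only [Matrix.sub_apply, Matrix.add_apply, mul_Fmat_apply, Fmat_mul_apply, hm,
        Matrix.of_apply, Matrix.zero_apply]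
      split_ifs with h
      · simp
      · have hi : (i : ℕ) = p - 1 := by omega
        simp [hi, hlast j j.2]
  · intro S S' R R' Z Z' hZ hZ' hM hN hM' hN'
    ext i j
    by_cases hij : (i : ℕ) = 0 ∧ (j : ℕ) < q - 1 - p
    · have e := eq_of_pencil_eq hZ hZ' hM hN hM' hN' (p - 1) i ⟨j + 1, by omega⟩
        (by omega) (by simp; omega)
      rw [← hN, ← hN']
      simp [mul_Kmat_apply, Kmat_mul_apply, hij.1, e]
    · rw [hZ i j hij, hZ' i j hij]
end

section
/- Let F be ℝ or ℂ, let p, q ≥ 1, and let λ ∈ F. For every pair of matrices M, N ∈ F^{p×q} there exist S ∈ F^{p×q}, R ∈ F^{(p−1)×q}, and a matrix H ∈ F^{p×q} that is zero outside its first row, such that M + S − F_p R = 0 and N + S J_q(λ) − K_p R = H; moreover H is uniquely determined by (M,N). -/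
open Matrix

/-- The `r × r` upper-triangular Jordan block `J_r(lam)`. -/
def jordanBlock (F : Type*) [Zero F] [One F] (r : ℕ) (lam : F) :
    Matrix (Fin r) (Fin r) F :=
  Matrix.of fun i j =>
    if (i : ℕ) = (j : ℕ) then lam else if (j : ℕ) = (i : ℕ) + 1 then 1 else 0

/-- `H` is zero outside its first row. -/
def IsFirstRow {F : Type*} [Zero F] {p q : ℕ} (H : Matrix (Fin p) (Fin q) F) : Prop :=
  ∀ (i : Fin p) (j : Fin q), (i : ℕ) ≠ 0 → H i j = 0

theorem Fmat_mul_castSucc {F : Type*} [Semiring F] {n q : ℕ}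
    (R : Matrix (Fin (n + 1 - 1)) (Fin q) F) (i : Fin n) (j : Fin q) :
    (Fmat F (n + 1) * R) i.castSucc j = R i j := by
  change ∑ k : Fin n, (if (i : ℕ) = (k : ℕ) then (1 : F) else 0) * R k j = R i j
  simp [← Fin.ext_iff]

theorem Fmat_mul_last {F : Type*} [Semiring F] {n q : ℕ}
    (R : Matrix (Fin (n + 1 - 1)) (Fin q) F) (j : Fin q) :
    (Fmat F (n + 1) * R) (Fin.last n) j = 0 := by
  change ∑ k : Fin n, (if n = (k : ℕ) then (1 : F) else 0) * R k j = 0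
  exact Finset.sum_eq_zero fun k _ => by simp [k.isLt.ne']

theorem Kmat_mul_succ {F : Type*} [Semiring F] {n q : ℕ}
    (R : Matrix (Fin (n + 1 - 1)) (Fin q) F) (i : Fin n) (j : Fin q) :
    (Kmat F (n + 1) * R) i.succ j = R i j := by
  change ∑ k : Fin n, (if (i : ℕ) + 1 = (k : ℕ) + 1 then (1 : F) else 0) * R k j = R i j
  simp [← Fin.ext_iff]

/-- Solvability modulo the first row, for an arbitrary square matrix `J`. -/
theorem exists_isFirstRow_add_Fmat_mul_sub {F : Type*} [Ring F] {n q : ℕ}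
    (J : Matrix (Fin q) (Fin q) F) (C : Matrix (Fin (n + 1)) (Fin q) F) :
    ∃ R : Matrix (Fin (n + 1 - 1)) (Fin q) F,
      IsFirstRow (C + Fmat F (n + 1) * R * J - Kmat F (n + 1) * R) := by
  let u : Fin (n + 1) → Fin q → F :=
    Fin.reverseInduction (motive := fun _ => Fin q → F) 0 fun i x => C i.succ + x ᵥ* J
  let R : Matrix (Fin (n + 1 - 1)) (Fin q) F := Matrix.of fun i => u (Fin.castSucc (n := n) i)
  have hu : Fmat F (n + 1) * (R : Matrix (Fin (n + 1 - 1)) (Fin q) F) = Matrix.of u := by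
    ext i j
    cases i using Fin.lastCases with
    | last => rw [Fmat_mul_last]; simp [u]
    | cast i => rw [Fmat_mul_castSucc]; rfl
  refine ⟨R, fun i j hi => ?_⟩
  cases i using Fin.cases with
  | zero => simp at hi
  | succ i =>
    have hR : R i j = C i.succ j + (u i.succ ᵥ* J) j := by simp [R, u]
    rw [hu, Matrix.sub_apply, Matrix.add_apply, Kmat_mul_succ, hR, mul_apply_eq_vecMul]
    exact sub_self _

/-- The solution `R` modulo the first row is unique. -/
theorem IsFirstRow.add_Fmat_mul_sub_unique {F : Type*} [Ring F] {n q : ℕ}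
    {J : Matrix (Fin q) (Fin q) F} {C : Matrix (Fin (n + 1)) (Fin q) F}
    {R R' : Matrix (Fin (n + 1 - 1)) (Fin q) F}
    (h : IsFirstRow (C + Fmat F (n + 1) * R * J - Kmat F (n + 1) * R))
    (h' : IsFirstRow (C + Fmat F (n + 1) * R' * J - Kmat F (n + 1) * R')) :
    R = R' := by
  have key : ∀ i : Fin (n + 1), (Fmat F (n + 1) * R) i = (Fmat F (n + 1) * R') i := by
    intro i
    induction i using Fin.reverseInduction with
    | last => ext j; exact (Fmat_mul_last R j).trans (Fmat_mul_last R' j).symm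
    | cast i ih =>
      ext j
      have e := h i.succ j (by simp)
      have e' := h' i.succ j (by simp)
      rw [Matrix.sub_apply, Matrix.add_apply, Kmat_mul_succ, mul_apply_eq_vecMul, sub_eq_zero] at e e'
      rw [Fmat_mul_castSucc, Fmat_mul_castSucc, ← e, ← e', ih]
  ext i j
  exact (Fmat_mul_castSucc R i j).symm.trans
    ((congrFun (key (Fin.castSucc (n := n) i)) j).trans (Fmat_mul_castSucc R' i j))

/-- Case 2 of the paper's Theorem 3.1: interaction of the Kronecker summands
`(F_p, K_p)` and `(I_q, J_q(λ))`. -/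
theorem pencil_case2 (F : Type*) [RCLike F] (p q : ℕ) (hp : 1 ≤ p) (hq : 1 ≤ q)
    (lam : F) (M N : Matrix (Fin p) (Fin q) F) :
    (∃ (S : Matrix (Fin p) (Fin q) F) (R : Matrix (Fin (p - 1)) (Fin q) F)
        (H : Matrix (Fin p) (Fin q) F), IsFirstRow H ∧
        M + S - Fmat F p * R = 0 ∧
        N + S * jordanBlock F q lam - Kmat F p * R = H) ∧
    (∀ (S S' : Matrix (Fin p) (Fin q) F) (R R' : Matrix (Fin (p - 1)) (Fin q) F)
        (H H' : Matrix (Fin p) (Fin q) F), IsFirstRow H → IsFirstRow H' →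
        M + S - Fmat F p * R = 0 →
        N + S * jordanBlock F q lam - Kmat F p * R = H →
        M + S' - Fmat F p * R' = 0 →
        N + S' * jordanBlock F q lam - Kmat F p * R' = H' → H = H') := by
  obtain ⟨n, rfl⟩ : ∃ n, p = n + 1 := ⟨p - 1, by omega⟩
  have expand (R : Matrix (Fin (n + 1 - 1)) (Fin q) F) :
      N + (Fmat F (n + 1) * R - M) * jordanBlock F q lam - Kmat F (n + 1) * R =
        (N - M * jordanBlock F q lam) + Fmat F (n + 1) * R * jordanBlock F q lam -
          Kmat F (n + 1) * R := by
    rw [Matrix.sub_mul]; abel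
  have solve {S : Matrix (Fin (n + 1)) (Fin q) F} {R : Matrix (Fin (n + 1 - 1)) (Fin q) F}
      (h : M + S - Fmat F (n + 1) * R = 0) : S = Fmat F (n + 1) * R - M :=
    eq_sub_of_add_eq' (sub_eq_zero.mp h)
  constructor
  · obtain ⟨R, hR⟩ := exists_isFirstRow_add_Fmat_mul_sub (jordanBlock F q lam)
      (N - M * jordanBlock F q lam)
    exact ⟨Fmat F (n + 1) * R - M, R, _, hR, by abel, expand R⟩
  · intro S S' R R' H H' hH hH' hS hN hS' hN'
    rw [solve hS, expand] at hN
    rw [solve hS', expand] at hN'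
    subst hN hN'
    rw [hH.add_Fmat_mul_sub_unique hH']
end

section
/- Let t_1, t_2, t_3, t_4 ≥ 0, and for each l ∈ {1,2,3,4} let r_{l1} ≥ r_{l2} ≥ … ≥ r_{l t_l} ≥ 1 be integers; let C ∈ ℂ^{c×c} be a nonsingular Jordan canonical matrix (block-diagonal of Jordan blocks with distinct nonzero eigenvalues, blocks of equal eigenvalue grouped together with non-increasing sizes). List the canonical summands in the order: the summand (I_c, C); then the type-1 summands (I_{r_{1j}}, J_{r_{1j}}), j = 1,…,t_1; then the type-2 summands (J_{r_{2j}}, I_{r_{2j}}); then the type-3 summands (F_{r_{3j}}, G_{r_{3j}}); then the type-4 summands (G_{r_{4j}}, F_{r_{4j}}). Let A ∈ ℂ^{m×n} be the block-diagonal matrix of the first components and B ∈ ℂ^{n×m} the block-diagonal matrix of the second components of these summands (the i-th summand contributing an (m_i rows)×(n_i columns) block to A and an (n_i)×(m_i) block to B, where for type 1 and 2 summands m_i = n_i = r; for a type-3 summand of size r, m_i = r, n_i = r−1; for a type-4 summand of size r, m_i = r−1, n_i = r). For an ordered pair of summands (i,j), the (i,j)-block of a matrix P ∈ ℂ^{m×n}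 is its m_i×n_j sub-block in the rows of summand i and columns of summand j, and the (i,j)-block of Q ∈ ℂ^{n×m} is its n_i×m_j sub-block; a block is said to be in H-form if all its entries outside the first column are zero when (number of rows) ≤ (number of columns), and all entries outside the last row are zero otherwise. Let 𝒫 ⊆ ℂ^{m×n} × ℂ^{n×m} consist of pairs (P,Q) such that: the only possibly nonzero blocks of P are, each in H-form, the (i,j)-blocks with i,j both of type 2; i of type 2 and j of type 3 or 4; i of type 3 or 4 and j of type 2; i,j both of type 3 with i ≤ j (in the listed order); i of type 3 and j of type 4; and i,j both of type 4 with i > j; and the only possibly nonzero blocks of Q are, each in H-form, the (i,j)-blocks with i,j both of type 1; i of type 1 and j of type 2, 3 or 4; i of type 2, 3 or 4 and j of type 1; i,j both of type 3 with i > j; i of type 4 and j of type 3; i,j both of type 4 with i ≤ j; together with, inside the (C,C)-block of Q, for each ordered pair of Jordan blocks of C having the same eigenvalue, the H-form support of the corresponding sub-block (no positions for pairs of Jordan blocks with different eigenvalues). Then ℂ^{m×n} × ℂ^{n×m} is the internal direct sum of 𝒫 and the subspace {(SA − AR, RB − BS) : S ∈ ℂ^{m×m}, R ∈ ℂ^{n×n}}.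 -/
open Matrix

namespace ContragredientComplex

/-- Entry `(a, b)` (0-indexed) of a Jordan block with eigenvalue `lam`. -/
def jordanEntry (lam : ℂ) (a b : ℕ) : ℂ :=
  if a = b then lam else if b = a + 1 then 1 else 0

/-- H-form support condition for a `rows × cols` block, at position `(a, b)`
(0-indexed): the first column if `rows ≤ cols`, the last row otherwise. -/
def Hcond (rows cols a b : ℕ) : Prop :=
  if rows ≤ cols then b = 0 else a = rows - 1

variable (t1 t2 t3 t4 : ℕ)
variable (r1 : Fin t1 → ℕ) (r2 : Fin t2 → ℕ) (r3 : Fin t3 → ℕ) (r4 : Fin t4 → ℕ)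
variable (s : ℕ) (lamC : Fin s → ℂ) (tC : Fin s → ℕ) (szC : ∀ i : Fin s, Fin (tC i) → ℕ)

/-- Index set of the Jordan canonical matrix `C`. -/
abbrev CI := Σ i : Fin s, Σ j : Fin (tC i), Fin (szC i j)

/-- Index set of the space `U` (rows of `A`, columns of `B`). -/
abbrev Mi := CI s tC szC ⊕ ((Σ j : Fin t1, Fin (r1 j)) ⊕ ((Σ j : Fin t2, Fin (r2 j)) ⊕
  ((Σ j : Fin t3, Fin (r3 j)) ⊕ (Σ j : Fin t4, Fin (r4 j - 1)))))

/-- Index set of the space `V` (columns of `A`, rows of `B`). -/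
abbrev Ni := CI s tC szC ⊕ ((Σ j : Fin t1, Fin (r1 j)) ⊕ ((Σ j : Fin t2, Fin (r2 j)) ⊕
  ((Σ j : Fin t3, Fin (r3 j - 1)) ⊕ (Σ j : Fin t4, Fin (r4 j)))))

/-- The first matrix `A`: block-diagonal with blocks `I_c`, `I_{r_{1j}}`, `J_{r_{2j}}`,
`F_{r_{3j}}`, `G_{r_{4j}}`. -/
def A : Matrix (Mi t1 t2 t3 t4 r1 r2 r3 r4 s tC szC) (Ni t1 t2 t3 t4 r1 r2 r3 r4 s tC szC) ℂ :=
  Matrix.of fun x y =>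
    match x, y with
    | Sum.inl c, Sum.inl c' => if c = c' then 1 else 0
    | Sum.inr (Sum.inl ⟨j, a⟩), Sum.inr (Sum.inl ⟨j', b⟩) =>
        if j = j' ∧ (a : ℕ) = (b : ℕ) then 1 else 0
    | Sum.inr (Sum.inr (Sum.inl ⟨j, a⟩)), Sum.inr (Sum.inr (Sum.inl ⟨j', b⟩)) =>
        if j = j' ∧ (b : ℕ) = (a : ℕ) + 1 then 1 else 0
    | Sum.inr (Sum.inr (Sum.inr (Sum.inl ⟨j, a⟩))), Sum.inr (Sum.inr (Sum.inr (Sum.inl ⟨j', b⟩))) =>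
        if j = j' ∧ (a : ℕ) = (b : ℕ) then 1 else 0
    | Sum.inr (Sum.inr (Sum.inr (Sum.inr ⟨j, a⟩))), Sum.inr (Sum.inr (Sum.inr (Sum.inr ⟨j', b⟩))) =>
        if j = j' ∧ (b : ℕ) = (a : ℕ) + 1 then 1 else 0
    | _, _ => 0

/-- The second matrix `B`: block-diagonal with blocks `C`, `J_{r_{1j}}`, `I_{r_{2j}}`,
`G_{r_{3j}}`, `F_{r_{4j}}`. -/
def B : Matrix (Ni t1 t2 t3 t4 r1 r2 r3 r4 s tC szC) (Mi t1 t2 t3 t4 r1 r2 r3 r4 s tC szC) ℂ :=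
  Matrix.of fun x y =>
    match x, y with
    | Sum.inl c, Sum.inl c' =>
        if c.1 = c'.1 ∧ (c.2.1 : ℕ) = (c'.2.1 : ℕ) then
          jordanEntry (lamC c.1) c.2.2 c'.2.2 else 0
    | Sum.inr (Sum.inl ⟨j, a⟩), Sum.inr (Sum.inl ⟨j', b⟩) =>
        if j = j' ∧ (b : ℕ) = (a : ℕ) + 1 then 1 else 0
    | Sum.inr (Sum.inr (Sum.inl ⟨j, a⟩)), Sum.inr (Sum.inr (Sum.inl ⟨j', b⟩)) =>
        if j = j' ∧ (a : ℕ) = (b : ℕ) then 1 else 0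
    | Sum.inr (Sum.inr (Sum.inr (Sum.inl ⟨j, a⟩))), Sum.inr (Sum.inr (Sum.inr (Sum.inl ⟨j', b⟩))) =>
        if j = j' ∧ (b : ℕ) = (a : ℕ) + 1 then 1 else 0
    | Sum.inr (Sum.inr (Sum.inr (Sum.inr ⟨j, a⟩))), Sum.inr (Sum.inr (Sum.inr (Sum.inr ⟨j', b⟩))) =>
        if j = j' ∧ (a : ℕ) = (b : ℕ) then 1 else 0
    | _, _ => 0

/-- Support of the first component `P ∈ ℂ^{m×n}` of the miniversal deformation. -/
def PSupp : Mi t1 t2 t3 t4 r1 r2 r3 r4 s tC szC → Ni t1 t2 t3 t4 r1 r2 r3 r4 s tC szC → Prop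
  | Sum.inr (Sum.inr (Sum.inl ⟨j, a⟩)), Sum.inr (Sum.inr (Sum.inl ⟨j', b⟩)) =>
      Hcond (r2 j) (r2 j') a b
  | Sum.inr (Sum.inr (Sum.inl ⟨j, a⟩)), Sum.inr (Sum.inr (Sum.inr (Sum.inl ⟨j', b⟩))) =>
      Hcond (r2 j) (r3 j' - 1) a b
  | Sum.inr (Sum.inr (Sum.inl ⟨j, a⟩)), Sum.inr (Sum.inr (Sum.inr (Sum.inr ⟨j', b⟩))) =>
      Hcond (r2 j) (r4 j') a b
  | Sum.inr (Sum.inr (Sum.inr (Sum.inl ⟨j, a⟩))), Sum.inr (Sum.inr (Sum.inl ⟨j', b⟩)) =>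
      Hcond (r3 j) (r2 j') a b
  | Sum.inr (Sum.inr (Sum.inr (Sum.inr ⟨j, a⟩))), Sum.inr (Sum.inr (Sum.inl ⟨j', b⟩)) =>
      Hcond (r4 j - 1) (r2 j') a b
  | Sum.inr (Sum.inr (Sum.inr (Sum.inl ⟨j, a⟩))), Sum.inr (Sum.inr (Sum.inr (Sum.inl ⟨j', b⟩))) =>
      (j : ℕ) ≤ (j' : ℕ) ∧ Hcond (r3 j) (r3 j' - 1) a b
  | Sum.inr (Sum.inr (Sum.inr (Sum.inl ⟨j, a⟩))), Sum.inr (Sum.inr (Sum.inr (Sum.inr ⟨j', b⟩))) =>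
      Hcond (r3 j) (r4 j') a b
  | Sum.inr (Sum.inr (Sum.inr (Sum.inr ⟨j, a⟩))), Sum.inr (Sum.inr (Sum.inr (Sum.inr ⟨j', b⟩))) =>
      (j' : ℕ) < (j : ℕ) ∧ Hcond (r4 j - 1) (r4 j') a b
  | _, _ => False

/-- Support of the second component `Q ∈ ℂ^{n×m}` of the miniversal deformation. -/
def QSupp : Ni t1 t2 t3 t4 r1 r2 r3 r4 s tC szC → Mi t1 t2 t3 t4 r1 r2 r3 r4 s tC szC → Prop
  | Sum.inl c, Sum.inl c' =>
      c.1 = c'.1 ∧ Hcond (szC c.1 c.2.1) (szC c'.1 c'.2.1) c.2.2 c'.2.2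
  | Sum.inr (Sum.inl ⟨j, a⟩), Sum.inr (Sum.inl ⟨j', b⟩) =>
      Hcond (r1 j) (r1 j') a b
  | Sum.inr (Sum.inl ⟨j, a⟩), Sum.inr (Sum.inr (Sum.inl ⟨j', b⟩)) =>
      Hcond (r1 j) (r2 j') a b
  | Sum.inr (Sum.inl ⟨j, a⟩), Sum.inr (Sum.inr (Sum.inr (Sum.inl ⟨j', b⟩))) =>
      Hcond (r1 j) (r3 j') a b
  | Sum.inr (Sum.inl ⟨j, a⟩), Sum.inr (Sum.inr (Sum.inr (Sum.inr ⟨j', b⟩))) =>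
      Hcond (r1 j) (r4 j' - 1) a b
  | Sum.inr (Sum.inr (Sum.inl ⟨j, a⟩)), Sum.inr (Sum.inl ⟨j', b⟩) =>
      Hcond (r2 j) (r1 j') a b
  | Sum.inr (Sum.inr (Sum.inr (Sum.inl ⟨j, a⟩))), Sum.inr (Sum.inl ⟨j', b⟩) =>
      Hcond (r3 j - 1) (r1 j') a b
  | Sum.inr (Sum.inr (Sum.inr (Sum.inr ⟨j, a⟩))), Sum.inr (Sum.inl ⟨j', b⟩) =>
      Hcond (r4 j) (r1 j') a b
  | Sum.inr (Sum.inr (Sum.inr (Sum.inl ⟨j, a⟩))), Sum.inr (Sum.inr (Sum.inr (Sum.inl ⟨j', b⟩))) =>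
      (j' : ℕ) < (j : ℕ) ∧ Hcond (r3 j - 1) (r3 j') a b
  | Sum.inr (Sum.inr (Sum.inr (Sum.inr ⟨j, a⟩))), Sum.inr (Sum.inr (Sum.inr (Sum.inl ⟨j', b⟩))) =>
      Hcond (r4 j) (r3 j') a b
  | Sum.inr (Sum.inr (Sum.inr (Sum.inr ⟨j, a⟩))), Sum.inr (Sum.inr (Sum.inr (Sum.inr ⟨j', b⟩))) =>
      (j : ℕ) ≤ (j' : ℕ) ∧ Hcond (r4 j) (r4 j' - 1) a b
  | _, _ => False

/-- The nilpotent upper-triangular Jordan block of size `m`. -/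
def shift (m : ℕ) : Matrix (Fin m) (Fin m) ℂ :=
  Matrix.of fun k l => if (l : ℕ) = k + 1 then 1 else 0

/-- Extension of a matrix by zero to a function on `ℕ × ℕ`. -/
def zeroExt {m n : ℕ} (X : Matrix (Fin m) (Fin n) ℂ) (k l : ℕ) : ℂ :=
  if h : k < m ∧ l < n then X ⟨k, h.1⟩ ⟨l, h.2⟩ else 0

/-- Sum of the entries on the diagonal through the position `(m - 1, l)`. -/
def diagSum (m : ℕ) (y : ℕ → ℕ → ℂ) (l : ℕ) : ℂ :=
  ∑ i ∈ Finset.range (l + 1), y (m - 1 - i) (l - i)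

lemma zeroExt_val {m n : ℕ} (X : Matrix (Fin m) (Fin n) ℂ) (k : Fin m) (l : Fin n) :
    zeroExt X k l = X k l := by
  simp [zeroExt]

lemma zeroExt_of_le_left {m n : ℕ} (X : Matrix (Fin m) (Fin n) ℂ) {k : ℕ} (l : ℕ) (h : m ≤ k) :
    zeroExt X k l = 0 := by
  simp [zeroExt, h.not_gt]

lemma zeroExt_sub {m n : ℕ} (X Y : Matrix (Fin m) (Fin n) ℂ) (k l : ℕ) :
    zeroExt (X - Y) k l = zeroExt X k l - zeroExt Y k l := by
  unfold zeroExt; split_ifs <;> simp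

lemma zeroExt_neg {m n : ℕ} (X : Matrix (Fin m) (Fin n) ℂ) (k l : ℕ) :
    zeroExt (-X) k l = -zeroExt X k l := by
  unfold zeroExt; split_ifs <;> simp

lemma mul_shift_apply {m n : ℕ} (X : Matrix (Fin m) (Fin n) ℂ) (k : Fin m) (l : Fin n) :
    (X * shift n) k l = if 0 < (l : ℕ) then zeroExt X k (l - 1) else 0 := by
  rw [Matrix.mul_apply]
  split_ifs with h
  · have hl : (l : ℕ) - 1 < n := by omega
    rw [Finset.sum_eq_single ⟨(l : ℕ) - 1, hl⟩]
    · have : (l : ℕ) = l - 1 + 1 := by omega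
      simp [shift, zeroExt, hl, ← this]
    · intro z _ hz
      have : (l : ℕ) ≠ z + 1 := fun h' => hz (Fin.ext (by simp [h']))
      simp [shift, this]
    · simp
  · exact Finset.sum_eq_zero fun z _ => by
      have : (l : ℕ) ≠ z + 1 := by omega
      simp [shift, this]

lemma shift_mul_apply {m n : ℕ} (X : Matrix (Fin m) (Fin n) ℂ) (k : Fin m) (l : Fin n) :
    (shift m * X) k l = zeroExt X (k + 1) l := by
  rw [Matrix.mul_apply]
  by_cases h : (k : ℕ) + 1 < m
  · rw [Finset.sum_eq_single ⟨(k : ℕ) + 1, h⟩]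
    · simp [shift, zeroExt, h]
    · intro z _ hz
      have : (z : ℕ) ≠ k + 1 := fun h' => hz (Fin.ext h')
      simp [shift, this]
    · simp
  · rw [zeroExt_of_le_left _ _ (not_lt.mp h)]
    exact Finset.sum_eq_zero fun z _ => by
      have : (z : ℕ) ≠ k + 1 := by omega
      simp [shift, this]

lemma diagSum_commutator {m n : ℕ} (X : Matrix (Fin m) (Fin n) ℂ) {l : ℕ} (hm : l < m)
    (hn : l < n) : diagSum m (zeroExt (X * shift n - shift m * X)) l = 0 := by
  set f : ℕ → ℂ := fun i => if i ≤ l then zeroExt X (m - i) (l - i) else 0 with hf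
  have key : ∀ i ∈ Finset.range (l + 1),
      zeroExt (X * shift n - shift m * X) (m - 1 - i) (l - i) = f (i + 1) - f i := by
    intro i hi
    have hi' : i ≤ l := by simpa [Nat.lt_succ_iff] using hi
    have h1 : m - 1 - i < m := by omega
    have h2 : l - i < n := by omega
    have e1 : m - 1 - i + 1 = m - i := by omega
    have e2 : m - (i + 1) = m - 1 - i := by omega
    have e3 : l - (i + 1) = l - i - 1 := by omega
    have e4 : i + 1 ≤ l ↔ 0 < l - i := by omega
    have := zeroExt_val (X * shift n - shift m * X) ⟨_, h1⟩ ⟨_, h2⟩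
    simp only at this
    rw [this, Matrix.sub_apply, mul_shift_apply, shift_mul_apply]
    simp only [hf, hi', if_true, e1, e2, e3, e4]
  rw [diagSum, Finset.sum_congr rfl key, Finset.sum_range_sub]
  simp [hf, zeroExt_of_le_left]

lemma exists_commutator_eq {m n : ℕ} (Y : Matrix (Fin m) (Fin n) ℂ)
    (hY : ∀ l, l < m → l < n → diagSum m (zeroExt Y) l = 0) :
    ∃ X : Matrix (Fin m) (Fin n) ℂ, Y = X * shift n - shift m * X := by
  set y := zeroExt Y with hy
  set x : ℕ → ℕ → ℂ := fun k l =>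
    if l < k then -∑ i ∈ Finset.range (l + 1), y (k - 1 - i) (l - i)
    else ∑ i ∈ Finset.range m, y (k + i) (l + 1 + i) with hx
  have hxX : ∀ k l, k < m → l < n →
      zeroExt (Matrix.of fun (k : Fin m) (l : Fin n) => x k l) k l = x k l := by
    intro k l hk hl
    simp [zeroExt, hk, hl]
  have hlast : ∀ l, l < n →
      zeroExt (Matrix.of fun (k : Fin m) (l : Fin n) => x k l) m l = x m l := by
    intro l hl
    rw [zeroExt_of_le_left _ _ le_rfl]
    simp only [hx]
    split_ifs with h
    · have := hY l h hl
      rw [diagSum] at this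
      rw [this, neg_zero]
    · exact (Finset.sum_eq_zero fun i _ => zeroExt_of_le_left _ _ (by omega)).symm
  refine ⟨Matrix.of fun k l => x k l, ?_⟩
  ext k l
  rw [Matrix.sub_apply, mul_shift_apply, shift_mul_apply, ← zeroExt_val Y, ← hy]
  have hk1 : zeroExt (Matrix.of fun (k : Fin m) (l : Fin n) => x k l) (k + 1) l = x (k + 1) l := by
    rcases Nat.lt_or_ge (k + 1) m with h | h
    · exact hxX _ _ h l.2
    · have : (k : ℕ) + 1 = m := by omega
      rw [this]
      exact hlast _ l.2
  rw [hk1]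
  by_cases hlk : (l : ℕ) ≤ k
  · have e : x (k + 1) l = -∑ i ∈ Finset.range ((l : ℕ) + 1), y (k - i) (l - i) := by
      simp only [hx]
      rw [if_pos (by omega)]
      simp
    rw [e]
    split_ifs with h0
    · rw [hxX _ _ k.2 (by omega)]
      obtain ⟨l', hl'⟩ : ∃ l' : ℕ, (l : ℕ) = l' + 1 := ⟨l - 1, by omega⟩
      simp only [hx, hl']
      rw [if_pos (by omega), Finset.sum_range_succ' _ (l' + 1)]
      simp [Nat.sub_sub, add_comm]
    · have : (l : ℕ) = 0 := by omega
      simp [this]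
  · rw [if_pos (by omega), hxX _ _ k.2 (by omega)]
    have e1 : x (k + 1) l = ∑ i ∈ Finset.range m, y (k + (i + 1)) (l + (i + 1)) := by
      simp only [hx]
      rw [if_neg (by omega)]
      exact Finset.sum_congr rfl fun i _ => by congr 1 <;> ring
    have e2 : x k (l - 1) = ∑ i ∈ Finset.range m, y (k + i) (l + i) := by
      simp only [hx]
      rw [if_neg (by omega), Nat.sub_add_cancel (by omega)]
    have e3 := Finset.sum_range_succ' (fun i => y (k + i) (l + i)) m
    rw [Finset.sum_range_succ, hy, zeroExt_of_le_left _ _ (Nat.le_add_left m k), ← hy] at e3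
    rw [e1, e2]
    simp only [add_zero] at e3
    rw [e3]
    ring

/-- The positions of `T` in an `m × n` array are a transversal of those diagonals on which the
commutator with the shift is not surjective and which meet `ok`. -/
structure IsTransversal (m n : ℕ) (ok T : ℕ → ℕ → Prop) : Prop where
  mem_diag : ∀ k l, k < m → l < n → T k l → l ≤ k ∧ m + l ≤ n + k
  unique : ∀ k l k' l', k < m → l < n → k' < m → l' < n → T k l → T k' l' →
    k + l' = k' + l → k = k'
  exists_mem : ∀ k l, k < m → l < n → ok k l → l ≤ k → m + l ≤ n + k →
    ∃ k' l', k' < m ∧ l' < n ∧ T k' l' ∧ k + l' = k' + l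

lemma diagSum_eq_single {m n : ℕ} {ok T : ℕ → ℕ → Prop} (hT : IsTransversal m n ok T)
    {y : ℕ → ℕ → ℂ} (hy : ∀ k l, ¬ T k l → y k l = 0) {k l : ℕ} (hk : k < m) (hl : l < n)
    (h : T k l) : diagSum m y (l + (m - 1 - k)) = y k l := by
  obtain ⟨h1, h2⟩ := hT.mem_diag k l hk hl h
  rw [diagSum, Finset.sum_eq_single (m - 1 - k)]
  · congr 1 <;> omega
  · intro i hi hne
    have hi' := Finset.mem_range.mp hi
    apply hy
    intro h'
    exact hne (by
      have := hT.unique k l _ _ hk hl (by omega) (by omega) h h' (by omega)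
      omega)
  · intro hn
    exact absurd (Finset.mem_range.mpr (by omega)) hn

lemma exists_add_commutator_eq {m n : ℕ} {ok T : ℕ → ℕ → Prop} (hT : IsTransversal m n ok T)
    (Y : Matrix (Fin m) (Fin n) ℂ) (hY : ∀ (k : Fin m) (l : Fin n), ¬ ok k l → Y k l = 0) :
    ∃ P X : Matrix (Fin m) (Fin n) ℂ,
      (∀ (k : Fin m) (l : Fin n), ¬ T k l → P k l = 0) ∧
      Y = P + (X * shift n - shift m * X) := by
  classical
  set P : Matrix (Fin m) (Fin n) ℂ := Matrix.of fun k l =>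
    if T k l then diagSum m (zeroExt Y) (l + (m - 1 - k)) else 0 with hP
  have hPT : ∀ k l, ¬ T k l → zeroExt P k l = 0 := by
    intro k l h
    simp only [zeroExt]
    split_ifs
    · simp [hP, h]
    · rfl
  have hsum : ∀ l, l < m → l < n → diagSum m (zeroExt (Y - P)) l = 0 := by
    intro l hm hn
    have e : diagSum m (zeroExt (Y - P)) l
        = diagSum m (zeroExt Y) l - diagSum m (zeroExt P) l := by
      simp only [diagSum, zeroExt_sub, Finset.sum_sub_distrib]
    rw [e]
    by_cases h : ∃ k' l', k' < m ∧ l' < n ∧ T k' l' ∧ m - 1 + l' = k' + l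
    · obtain ⟨k', l', hk', hl', h', hd⟩ := h
      have e1 : l = l' + (m - 1 - k') := by omega
      have e2 := diagSum_eq_single hT hPT hk' hl' h'
      rw [← e1] at e2
      rw [e2]
      simp [zeroExt, hk', hl', hP, h', ← e1]
    · have hz : ∀ i ∈ Finset.range (l + 1), zeroExt Y (m - 1 - i) (l - i) = 0 := by
        intro i hi
        have hi' := Finset.mem_range.mp hi
        have h1 : m - 1 - i < m := by omega
        have h2 : l - i < n := by omega
        simp only [zeroExt, h1, h2, and_self, dite_true]
        apply hY
        intro hok
        obtain ⟨k', l', hk', hl', h', hd⟩ :=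
          hT.exists_mem _ _ h1 h2 hok (by omega) (by omega)
        exact h ⟨k', l', hk', hl', h', by omega⟩
      have hz' : ∀ i ∈ Finset.range (l + 1), zeroExt P (m - 1 - i) (l - i) = 0 := by
        intro i hi
        have hi' := Finset.mem_range.mp hi
        apply hPT
        intro h'
        exact h ⟨_, _, by omega, by omega, h', by omega⟩
      rw [diagSum, diagSum, Finset.sum_eq_zero hz, Finset.sum_eq_zero hz', sub_zero]
  obtain ⟨X, hX⟩ := exists_commutator_eq (Y - P) hsum
  exact ⟨P, X, fun k l h => by simp [hP, h], by rw [← hX]; abel⟩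

lemma eq_zero_of_add_commutator_eq_zero {m n : ℕ} {ok T : ℕ → ℕ → Prop}
    (hT : IsTransversal m n ok T) (P X : Matrix (Fin m) (Fin n) ℂ)
    (hP : ∀ k l : ℕ, ¬ T k l → zeroExt P k l = 0)
    (h : P + (X * shift n - shift m * X) = 0) : P = 0 := by
  ext k l
  by_cases hkl : T k l
  · obtain ⟨h1, h2⟩ := hT.mem_diag k l k.2 l.2 hkl
    rw [← zeroExt_val P, ← diagSum_eq_single hT hP k.2 l.2 hkl, eq_neg_of_add_eq_zero_left h]
    have e := diagSum_commutator X (l := l + (m - 1 - k)) (by omega) (by omega)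
    simp only [diagSum, zeroExt_neg, Finset.sum_neg_distrib] at e ⊢
    rw [e, neg_zero, Matrix.zero_apply]
  · rw [← zeroExt_val P, hP _ _ hkl, Matrix.zero_apply]

lemma shift_pow_apply {m p : ℕ} (k l : Fin m) (h : (l : ℕ) < k + p) : (shift m ^ p) k l = 0 := by
  induction p generalizing l with
  | zero =>
    have : k ≠ l := by rintro rfl; omega
    simp [this]
  | succ p ih =>
    rw [pow_succ, mul_shift_apply]
    split_ifs with h0
    · have hl : (l : ℕ) - 1 < m := by omega
      have := ih ⟨(l : ℕ) - 1, hl⟩ (by simp only; omega)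
      simpa [zeroExt, hl] using this
    · rfl

lemma shift_pow_eq_zero {m p : ℕ} (h : m ≤ p) : shift m ^ p = 0 := by
  ext k l
  exact shift_pow_apply k l (by omega)

lemma isUnit_smul_one_add_shift (m : ℕ) {c : ℂ} (hc : c ≠ 0) :
    IsUnit (c • (1 : Matrix (Fin m) (Fin m) ℂ) + shift m) := by
  refine IsNilpotent.isUnit_add_left_of_commute ⟨m, shift_pow_eq_zero le_rfl⟩ ?_ ?_
  · exact (Units.mk0 c hc • (1 : (Matrix (Fin m) (Fin m) ℂ)ˣ)).isUnit
  · exact (Commute.one_right _).smul_right c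

section Sylvester

variable {m n : Type*} [Fintype m] [Fintype n] [DecidableEq m] [DecidableEq n]

lemma exists_mul_sub_mul_eq {E : Matrix n n ℂ} {G : Matrix m m ℂ} (hE : IsNilpotent E)
    (hG : IsUnit G) (Z : Matrix m n ℂ) : ∃ X : Matrix m n ℂ, X * E - G * X = Z := by
  obtain ⟨p, hp⟩ := hE
  obtain ⟨u, rfl⟩ := hG
  set v : Matrix m m ℂ := ↑u⁻¹ with hv
  have huv : (u : Matrix m m ℂ) * v = 1 := u.mul_inv
  refine ⟨-∑ i ∈ Finset.range p, v ^ (i + 1) * Z * E ^ i, ?_⟩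
  have h := Finset.sum_range_sub' (fun i => v ^ i * Z * E ^ i) p
  simp only [hp, Matrix.mul_zero, sub_zero, pow_zero, Matrix.one_mul, Matrix.mul_one,
    Finset.sum_sub_distrib] at h
  rw [Matrix.neg_mul, Matrix.mul_neg, Matrix.sum_mul, Matrix.mul_sum, sub_neg_eq_add,
    neg_add_eq_sub]
  refine Eq.trans ?_ h
  congr 1
  · refine Finset.sum_congr rfl fun i _ => ?_
    rw [pow_succ', Matrix.mul_assoc, Matrix.mul_assoc, ← Matrix.mul_assoc, ← Matrix.mul_assoc,
      huv, Matrix.one_mul, Matrix.mul_assoc]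
  · refine Finset.sum_congr rfl fun i _ => ?_
    rw [pow_succ E, Matrix.mul_assoc]

lemma eq_zero_of_mul_sub_mul_eq_zero {E : Matrix n n ℂ} {G : Matrix m m ℂ} (hE : IsNilpotent E)
    (hG : IsUnit G) {X : Matrix m n ℂ} (h : X * E - G * X = 0) : X = 0 := by
  obtain ⟨p, hp⟩ := hE
  obtain ⟨u, rfl⟩ := hG
  have key : ∀ i : ℕ, X * E ^ i = (u : Matrix m m ℂ) ^ i * X := by
    intro i
    induction i with
    | zero => simp
    | succ i ih =>
      rw [pow_succ, ← Matrix.mul_assoc, ih, Matrix.mul_assoc, sub_eq_zero.mp h,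
        ← Matrix.mul_assoc, ← pow_succ]
  have h2 := key p
  rw [hp, Matrix.mul_zero] at h2
  calc X = (↑(u ^ p)⁻¹ : Matrix m m ℂ) * ((↑(u ^ p) : Matrix m m ℂ) * X) := by
        rw [← Matrix.mul_assoc, Units.inv_mul, Matrix.one_mul]
    _ = 0 := by rw [Units.val_pow_eq_pow_val, ← h2, Matrix.mul_zero]

lemma isNilpotent_transpose {E : Matrix n n ℂ} (hE : IsNilpotent E) : IsNilpotent Eᵀ := by
  obtain ⟨p, hp⟩ := hE
  exact ⟨p, by rw [← Matrix.transpose_pow, hp, Matrix.transpose_zero]⟩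

lemma exists_mul_sub_mul_eq' {E : Matrix m m ℂ} {G : Matrix n n ℂ} (hE : IsNilpotent E)
    (hG : IsUnit G) (Z : Matrix m n ℂ) : ∃ X : Matrix m n ℂ, X * G - E * X = Z := by
  obtain ⟨X, hX⟩ := exists_mul_sub_mul_eq (isNilpotent_transpose hE)
    ((Matrix.isUnit_transpose G).mpr hG) (-Zᵀ)
  refine ⟨Xᵀ, Matrix.transpose_injective ?_⟩
  rw [Matrix.transpose_sub, Matrix.transpose_mul, Matrix.transpose_mul, Matrix.transpose_transpose,
    ← neg_sub, hX, neg_neg]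

end Sylvester

/-- The matrices supported on `T` complement the commutators with `J`, as far as matrices
supported on `ok` are concerned. -/
def IsComplement {K : Type*} [Fintype K] (J : Matrix K K ℂ) (ok T : K → K → Prop) : Prop :=
  (∀ Y : Matrix K K ℂ, (∀ x y, ¬ ok x y → Y x y = 0) →
    ∃ P X : Matrix K K ℂ, (∀ x y, ¬ T x y → P x y = 0) ∧ Y = P + (X * J - J * X)) ∧
  ∀ P X : Matrix K K ℂ, (∀ x y, ¬ T x y → P x y = 0) → P + (X * J - J * X) = 0 → P = 0

lemma IsComplement.submatrix {K K' : Type*} [Fintype K] [Fintype K'] {J : Matrix K K ℂ}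
    {ok T : K → K → Prop} (h : IsComplement J ok T) (e : K' ≃ K) :
    IsComplement (J.submatrix e e) (fun x y => ok (e x) (e y)) (fun x y => T (e x) (e y)) := by
  constructor
  · intro Y hY
    obtain ⟨P, X, hP, hX⟩ := h.1 (Y.submatrix e.symm e.symm)
      fun x y hxy => hY _ _ (by simpa using hxy)
    refine ⟨P.submatrix e e, X.submatrix e e, fun x y hxy => hP _ _ hxy, ?_⟩
    rw [Matrix.submatrix_mul_equiv, Matrix.submatrix_mul_equiv]
    ext x y
    simpa using congrFun₂ hX (e x) (e y)
  · intro P X hP hX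
    have h0 := h.2 (P.submatrix e.symm e.symm) (X.submatrix e.symm e.symm)
      (fun x y hxy => hP _ _ (by simpa using hxy)) (by
        have hJ : J = (J.submatrix e e).submatrix e.symm e.symm := by simp
        rw [hJ, Matrix.submatrix_mul_equiv, Matrix.submatrix_mul_equiv]
        ext x y
        exact congrFun₂ hX (e.symm x) (e.symm y))
    ext x y
    simpa using congrFun₂ h0 (e x) (e y)

section Jordan

variable {ι : Type*} [Fintype ι] [DecidableEq ι] (L : ι → ℕ) (ev : ι → ℂ)

/-- The Jordan matrix with blocks of sizes `L τ` and eigenvalues `ev τ`. -/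
def jordanMatrix : Matrix (Σ τ, Fin (L τ)) (Σ τ, Fin (L τ)) ℂ :=
  Matrix.blockDiagonal' fun τ => ev τ • 1 + shift (L τ)

lemma isUnit_jordanMatrix (h : ∀ τ, ev τ ≠ 0) : IsUnit (jordanMatrix L ev) :=
  IsUnit.map (Matrix.blockDiagonal'RingHom (fun τ => Fin (L τ)) ℂ)
    (Pi.isUnit_iff.mpr fun τ => isUnit_smul_one_add_shift (L τ) (h τ))

lemma isNilpotent_jordanMatrix : IsNilpotent (jordanMatrix L 0) := by
  refine ⟨∑ τ, L τ, ?_⟩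
  rw [jordanMatrix, ← Matrix.blockDiagonal'_pow]
  have h : (fun τ => (0 : ι → ℂ) τ • (1 : Matrix (Fin (L τ)) (Fin (L τ)) ℂ) + shift (L τ)) ^
      ∑ τ, L τ = 0 := by
    ext1 τ
    simpa using shift_pow_eq_zero
      (Finset.single_le_sum (f := L) (fun _ _ => Nat.zero_le _) (Finset.mem_univ τ))
  rw [h, Matrix.blockDiagonal'_zero]

variable {L}

/-- The `(τ, τ')` block of a matrix indexed by a sigma type. -/
def sigmaBlock (X : Matrix (Σ τ, Fin (L τ)) (Σ τ, Fin (L τ)) ℂ) (τ τ' : ι) :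
    Matrix (Fin (L τ)) (Fin (L τ')) ℂ :=
  Matrix.of fun k l => X ⟨τ, k⟩ ⟨τ', l⟩

lemma sigmaBlock_commutator (X : Matrix (Σ τ, Fin (L τ)) (Σ τ, Fin (L τ)) ℂ) (τ τ' : ι) :
    sigmaBlock (X * jordanMatrix L ev - jordanMatrix L ev * X) τ τ' =
      sigmaBlock X τ τ' * shift (L τ') -
        ((ev τ - ev τ') • 1 + shift (L τ)) * sigmaBlock X τ τ' := by
  have h1 : sigmaBlock (X * jordanMatrix L ev) τ τ' =
      sigmaBlock X τ τ' * (ev τ' • 1 + shift (L τ')) := by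
    ext k l
    simp only [sigmaBlock, Matrix.of_apply, Matrix.mul_apply, jordanMatrix, Fintype.sum_sigma]
    rw [Finset.sum_eq_single τ']
    · simp only [Matrix.blockDiagonal'_apply_eq]
    · intro σ _ hσ
      exact Finset.sum_eq_zero fun z _ => by rw [Matrix.blockDiagonal'_apply_ne _ _ _ hσ, mul_zero]
    · simp
  have h2 : sigmaBlock (jordanMatrix L ev * X) τ τ' =
      (ev τ • 1 + shift (L τ)) * sigmaBlock X τ τ' := by
    ext k l
    simp only [sigmaBlock, Matrix.of_apply, Matrix.mul_apply, jordanMatrix, Fintype.sum_sigma]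
    rw [Finset.sum_eq_single τ]
    · simp only [Matrix.blockDiagonal'_apply_eq]
    · intro σ _ hσ
      exact Finset.sum_eq_zero fun z _ => by
        rw [Matrix.blockDiagonal'_apply_ne _ _ _ hσ.symm, zero_mul]
    · simp
  have h3 : sigmaBlock (X * jordanMatrix L ev - jordanMatrix L ev * X) τ τ' =
      sigmaBlock (X * jordanMatrix L ev) τ τ' - sigmaBlock (jordanMatrix L ev * X) τ τ' := rfl
  rw [h3, h1, h2, sub_smul]
  simp only [Matrix.mul_add, Matrix.add_mul, Matrix.sub_mul, Matrix.mul_smul, Matrix.smul_mul,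
    Matrix.mul_one, Matrix.one_mul]
  abel

lemma isComplement_jordanMatrix (ok T : ι → ι → ℕ → ℕ → Prop)
    (hT : ∀ τ τ', ev τ = ev τ' → IsTransversal (L τ) (L τ') (ok τ τ') (T τ τ'))
    (hT' : ∀ τ τ' k l, T τ τ' k l → ev τ = ev τ') :
    IsComplement (jordanMatrix L ev) (fun x y => ok x.1 y.1 x.2 y.2)
      (fun x y => T x.1 y.1 x.2 y.2) := by
  constructor
  · intro Y hY
    have hblock : ∀ τ τ', ∃ P X : Matrix (Fin (L τ)) (Fin (L τ')) ℂ,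
        (∀ (k : Fin (L τ)) (l : Fin (L τ')), ¬ T τ τ' k l → P k l = 0) ∧ sigmaBlock Y τ τ' =
          P + (X * shift (L τ') - ((ev τ - ev τ') • 1 + shift (L τ)) * X) := by
      intro τ τ'
      by_cases h : ev τ = ev τ'
      · obtain ⟨P, X, hP, hX⟩ := exists_add_commutator_eq (hT τ τ' h) (sigmaBlock Y τ τ')
          fun k l hkl => hY _ _ hkl
        exact ⟨P, X, hP, by simpa [h] using hX⟩
      · obtain ⟨X, hX⟩ := exists_mul_sub_mul_eq ⟨_, shift_pow_eq_zero (m := L τ') le_rfl⟩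
          (isUnit_smul_one_add_shift (L τ) (sub_ne_zero.mpr h)) (sigmaBlock Y τ τ')
        exact ⟨0, X, fun _ _ _ => rfl, by rw [hX, zero_add]⟩
    choose P X hP hX using hblock
    refine ⟨Matrix.of fun x y => P x.1 y.1 x.2 y.2, Matrix.of fun x y => X x.1 y.1 x.2 y.2,
      fun x y h => hP _ _ _ _ h, ?_⟩
    ext ⟨τ, k⟩ ⟨τ', l⟩
    have h1 := congrFun₂ (hX τ τ') k l
    have h2 := congrFun₂ (sigmaBlock_commutator ev
      (Matrix.of fun x y : Σ τ, Fin (L τ) => X x.1 y.1 x.2 y.2) τ τ') k l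
    exact h1.trans (congrArg (P τ τ' k l + ·) h2.symm)
  · intro P X hP h
    ext ⟨τ, k⟩ ⟨τ', l⟩
    by_cases hev : ev τ = ev τ'
    · have h1 : sigmaBlock P τ τ' +
          sigmaBlock (X * jordanMatrix L ev - jordanMatrix L ev * X) τ τ' = 0 := by
        ext k l
        exact congrFun₂ h ⟨τ, k⟩ ⟨τ', l⟩
      rw [sigmaBlock_commutator, hev, sub_self, zero_smul, zero_add] at h1
      refine congrFun₂ (eq_zero_of_add_commutator_eq_zero (hT τ τ' hev) _ _ ?_ h1) k l
      intro k l hkl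
      unfold zeroExt
      split_ifs
      · exact hP _ _ hkl
      · rfl
    · exact hP _ _ fun h' => hev (hT' _ _ _ _ h')

end Jordan

/-- The pairs supported on `PS` and `QS` complement the tangent space at `(E, F)`. -/
def IsMiniversal {M N : Type*} [Fintype M] [Fintype N] (E : Matrix M N ℂ) (F : Matrix N M ℂ)
    (PS : M → N → Prop) (QS : N → M → Prop) : Prop :=
  (∀ (Y : Matrix M N ℂ) (Z : Matrix N M ℂ),
    ∃ (P : Matrix M N ℂ) (Q : Matrix N M ℂ) (S : Matrix M M ℂ) (R : Matrix N N ℂ),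
      (∀ x y, ¬ PS x y → P x y = 0) ∧ (∀ x y, ¬ QS x y → Q x y = 0) ∧
      Y = P + (S * E - E * R) ∧ Z = Q + (R * F - F * S)) ∧
  ∀ (P : Matrix M N ℂ) (Q : Matrix N M ℂ) (S : Matrix M M ℂ) (R : Matrix N N ℂ),
    (∀ x y, ¬ PS x y → P x y = 0) → (∀ x y, ¬ QS x y → Q x y = 0) →
    P + (S * E - E * R) = 0 → Q + (R * F - F * S) = 0 → P = 0 ∧ Q = 0

lemma fromBlocks_commutator {M N : Type*} [Fintype M] [Fintype N] (E : Matrix M N ℂ)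
    (F : Matrix N M ℂ) (S : Matrix M M ℂ) (S' : Matrix M N ℂ) (R' : Matrix N M ℂ)
    (R : Matrix N N ℂ) (P : Matrix M N ℂ) (Q : Matrix N M ℂ) (P' : Matrix M M ℂ)
    (Q' : Matrix N N ℂ) :
    fromBlocks P' P Q Q' + (fromBlocks S S' R' R * fromBlocks 0 E F 0 -
        fromBlocks 0 E F 0 * fromBlocks S S' R' R) =
      fromBlocks (P' + (S' * F - E * R')) (P + (S * E - E * R)) (Q + (R * F - F * S))
        (Q' + (R' * E - F * S')) := by
  simp [Matrix.fromBlocks_multiply, sub_eq_add_neg, Matrix.fromBlocks_neg, Matrix.fromBlocks_add]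

lemma IsComplement.isMiniversal {M N : Type*} [Fintype M] [Fintype N] {E : Matrix M N ℂ}
    {F : Matrix N M ℂ} {ok T : M ⊕ N → M ⊕ N → Prop}
    (h : IsComplement (fromBlocks 0 E F 0) ok T)
    (hok : ∀ x y, ok (Sum.inl x) (Sum.inr y)) (hok' : ∀ x y, ok (Sum.inr x) (Sum.inl y)) :
    IsMiniversal E F (fun x y => T (Sum.inl x) (Sum.inr y))
      (fun x y => T (Sum.inr x) (Sum.inl y)) := by
  constructor
  · intro Y Z
    obtain ⟨P, X, hP, hX⟩ := h.1 (fromBlocks 0 Y Z 0) (by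
      rintro (x | x) (y | y) hxy
      · rfl
      · exact absurd (hok x y) hxy
      · exact absurd (hok' x y) hxy
      · rfl)
    refine ⟨P.toBlocks₁₂, P.toBlocks₂₁, X.toBlocks₁₁, X.toBlocks₂₂, fun x y => hP _ _,
      fun x y => hP _ _, ?_⟩
    rw [← Matrix.fromBlocks_toBlocks P, ← Matrix.fromBlocks_toBlocks X, fromBlocks_commutator,
      Matrix.fromBlocks_inj] at hX
    exact ⟨hX.2.1, hX.2.2.1⟩
  · intro P Q S R hP hQ h1 h2
    have h0 := h.2 (fromBlocks 0 P Q 0) (fromBlocks S 0 0 R) (by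
      rintro (x | x) (y | y) hxy
      · rfl
      · exact hP _ _ hxy
      · exact hQ _ _ hxy
      · rfl) (by rw [fromBlocks_commutator, h1, h2]; simp)
    rw [← Matrix.fromBlocks_zero, Matrix.fromBlocks_inj] at h0
    exact ⟨h0.2.1, h0.2.2.1⟩

lemma IsComplement.isMiniversal_one {I : Type*} [Fintype I] [DecidableEq I] {G : Matrix I I ℂ}
    {T : I → I → Prop} (h : IsComplement G (fun _ _ => True) T) :
    IsMiniversal 1 G (fun _ _ => False) T := by
  constructor
  · intro Y Z
    obtain ⟨Q, S, hQ, hS⟩ := h.1 (Z + Y * G) (by simp)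
    refine ⟨0, Q, S, S - Y, fun _ _ _ => rfl, hQ, by simp, ?_⟩
    rw [Matrix.sub_mul, sub_sub, add_comm (Y * G), ← sub_sub, ← add_sub_assoc, ← hS,
      add_sub_cancel_right]
  · intro P Q S R hP hQ h1 h2
    have hP0 : P = 0 := by ext x y; exact hP x y not_false
    rw [hP0, zero_add, Matrix.mul_one, Matrix.one_mul, sub_eq_zero] at h1
    exact ⟨hP0, h.2 Q R hQ (h1 ▸ h2)⟩

lemma IsMiniversal.fromBlocks {I M N : Type*} [Fintype I] [Fintype M] [Fintype N]
    [DecidableEq I] [DecidableEq M] [DecidableEq N] {G : Matrix I I ℂ} {E : Matrix M N ℂ}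
    {F : Matrix N M ℂ} {PS₁ QS₁ : I → I → Prop} {PS₂ : M → N → Prop} {QS₂ : N → M → Prop}
    (h₁ : IsMiniversal 1 G PS₁ QS₁) (h₂ : IsMiniversal E F PS₂ QS₂)
    (hG : IsUnit G) (hEF : IsNilpotent (E * F)) (hFE : IsNilpotent (F * E))
    {PS : I ⊕ M → I ⊕ N → Prop} {QS : I ⊕ N → I ⊕ M → Prop}
    (hPS₁ : ∀ x y, PS (Sum.inl x) (Sum.inl y) ↔ PS₁ x y)
    (hPS₂ : ∀ x y, PS (Sum.inr x) (Sum.inr y) ↔ PS₂ x y)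
    (hQS₁ : ∀ x y, QS (Sum.inl x) (Sum.inl y) ↔ QS₁ x y)
    (hQS₂ : ∀ x y, QS (Sum.inr x) (Sum.inr y) ↔ QS₂ x y)
    (hPS₁₂ : ∀ x y, ¬ PS (Sum.inl x) (Sum.inr y)) (hPS₂₁ : ∀ x y, ¬ PS (Sum.inr x) (Sum.inl y))
    (hQS₁₂ : ∀ x y, ¬ QS (Sum.inl x) (Sum.inr y)) (hQS₂₁ : ∀ x y, ¬ QS (Sum.inr x) (Sum.inl y)) :
    IsMiniversal (Matrix.fromBlocks 1 0 0 E) (Matrix.fromBlocks G 0 0 F) PS QS := by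
  constructor
  · intro Y Z
    obtain ⟨P₁, Q₁, S₁, R₁, hP₁, hQ₁, hY₁, hZ₁⟩ := h₁.1 Y.toBlocks₁₁ Z.toBlocks₁₁
    obtain ⟨P₂, Q₂, S₂, R₂, hP₂, hQ₂, hY₂, hZ₂⟩ := h₂.1 Y.toBlocks₂₂ Z.toBlocks₂₂
    obtain ⟨S₁₂, hS⟩ := exists_mul_sub_mul_eq hEF hG (Z.toBlocks₁₂ + Y.toBlocks₁₂ * F)
    obtain ⟨R₂₁, hR⟩ := exists_mul_sub_mul_eq' hFE hG (Z.toBlocks₂₁ + F * Y.toBlocks₂₁)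
    refine ⟨Matrix.fromBlocks P₁ 0 0 P₂, Matrix.fromBlocks Q₁ 0 0 Q₂,
      Matrix.fromBlocks S₁ S₁₂ (Y.toBlocks₂₁ + E * R₂₁) S₂,
      Matrix.fromBlocks R₁ (S₁₂ * E - Y.toBlocks₁₂) R₂₁ R₂, ?_, ?_, ?_, ?_⟩
    · rintro (x | x) (y | y) h
      · exact hP₁ _ _ (by rwa [← hPS₁])
      · rfl
      · rfl
      · exact hP₂ _ _ (by rwa [← hPS₂])
    · rintro (x | x) (y | y) h
      · exact hQ₁ _ _ (by rwa [← hQS₁])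
      · rfl
      · rfl
      · exact hQ₂ _ _ (by rwa [← hQS₂])
    · conv_lhs => rw [← Matrix.fromBlocks_toBlocks Y]
      simp only [Matrix.fromBlocks_multiply, sub_eq_add_neg, Matrix.fromBlocks_neg,
        Matrix.fromBlocks_add, Matrix.fromBlocks_inj, Matrix.mul_zero, Matrix.zero_mul, add_zero,
        zero_add, Matrix.mul_one, Matrix.one_mul]
      refine ⟨by simpa [sub_eq_add_neg] using hY₁, by abel, by abel,
        by simpa [sub_eq_add_neg] using hY₂⟩
    · conv_lhs => rw [← Matrix.fromBlocks_toBlocks Z]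
      simp only [Matrix.fromBlocks_multiply, sub_eq_add_neg, Matrix.fromBlocks_neg,
        Matrix.fromBlocks_add, Matrix.fromBlocks_inj, Matrix.mul_zero, Matrix.zero_mul, add_zero,
        zero_add]
      refine ⟨by simpa [sub_eq_add_neg] using hZ₁, ?_, ?_, by simpa [sub_eq_add_neg] using hZ₂⟩
      · rw [Matrix.add_mul, Matrix.neg_mul, Matrix.mul_assoc, add_right_comm,
          ← sub_eq_add_neg (S₁₂ * (E * F)), hS]
        abel
      · rw [Matrix.mul_add, ← Matrix.mul_assoc, neg_add_rev, ← add_assoc,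
          ← sub_eq_add_neg (R₂₁ * G), hR]
        abel
  · intro P Q S R hP hQ h1 h2
    have hP12 : P.toBlocks₁₂ = 0 := by ext x y; exact hP _ _ (hPS₁₂ x y)
    have hP21 : P.toBlocks₂₁ = 0 := by ext x y; exact hP _ _ (hPS₂₁ x y)
    have hQ12 : Q.toBlocks₁₂ = 0 := by ext x y; exact hQ _ _ (hQS₁₂ x y)
    have hQ21 : Q.toBlocks₂₁ = 0 := by ext x y; exact hQ _ _ (hQS₂₁ x y)
    rw [← Matrix.fromBlocks_toBlocks P, ← Matrix.fromBlocks_toBlocks S,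
      ← Matrix.fromBlocks_toBlocks R] at h1
    rw [← Matrix.fromBlocks_toBlocks Q, ← Matrix.fromBlocks_toBlocks S,
      ← Matrix.fromBlocks_toBlocks R] at h2
    simp only [Matrix.fromBlocks_multiply, sub_eq_add_neg, Matrix.fromBlocks_neg,
        Matrix.fromBlocks_add, Matrix.mul_zero, Matrix.zero_mul, add_zero,
        zero_add] at h1 h2
    rw [← Matrix.fromBlocks_zero, Matrix.fromBlocks_inj] at h1 h2
    simp only [← sub_eq_add_neg] at h1 h2
    obtain ⟨a1, b1⟩ := h₁.2 _ _ _ _ (fun x y h => hP _ _ (by rwa [hPS₁]))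
      (fun x y h => hQ _ _ (by rwa [hQS₁])) h1.1 h2.1
    obtain ⟨a2, b2⟩ := h₂.2 _ _ _ _ (fun x y h => hP _ _ (by rwa [hPS₂]))
      (fun x y h => hQ _ _ (by rwa [hQS₂])) h1.2.2.2 h2.2.2.2
    rw [← Matrix.fromBlocks_toBlocks P, ← Matrix.fromBlocks_toBlocks Q, hP12, hP21, hQ12, hQ21]
    constructor
    · rw [← Matrix.fromBlocks_zero, Matrix.fromBlocks_inj]
      exact ⟨a1, rfl, rfl, a2⟩
    · rw [← Matrix.fromBlocks_zero, Matrix.fromBlocks_inj]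
      exact ⟨b1, rfl, rfl, b2⟩

lemma isNilpotent_of_fromBlocks {M N : Type*} [Fintype M] [Fintype N] [DecidableEq M]
    [DecidableEq N] {E : Matrix M N ℂ} {F : Matrix N M ℂ}
    (h : IsNilpotent (Matrix.fromBlocks 0 E F 0)) : IsNilpotent (E * F) ∧ IsNilpotent (F * E) := by
  obtain ⟨p, hp⟩ := h
  have h2 : (Matrix.fromBlocks 0 E F 0 ^ 2) ^ p = 0 := by
    rw [← pow_mul', pow_mul, hp, zero_pow two_ne_zero]
  rw [pow_two, Matrix.fromBlocks_multiply] at h2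
  simp only [Matrix.zero_mul, Matrix.mul_zero, zero_add, add_zero] at h2
  rw [Matrix.fromBlocks_diagonal_pow, ← Matrix.fromBlocks_zero, Matrix.fromBlocks_inj] at h2
  exact ⟨⟨p, h2.1⟩, ⟨p, h2.2.2.2⟩⟩

lemma jordanMatrix_apply {ι : Type*} [Fintype ι] [DecidableEq ι] (L : ι → ℕ) (ev : ι → ℂ)
    (x y : Σ τ, Fin (L τ)) :
    jordanMatrix L ev x y = if x.1 = y.1 then jordanEntry (ev x.1) x.2 y.2 else 0 := by
  obtain ⟨τ, k⟩ := x
  obtain ⟨τ', l⟩ := y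
  by_cases h : τ = τ'
  · subst h
    by_cases hkl : k = l
    · subst hkl
      simp [jordanMatrix, Matrix.blockDiagonal'_apply_eq, jordanEntry, shift]
    · have : (k : ℕ) ≠ l := fun h => hkl (Fin.ext h)
      simp [jordanMatrix, Matrix.blockDiagonal'_apply_eq, jordanEntry, shift, hkl, this]
  · simp [jordanMatrix, Matrix.blockDiagonal'_apply_ne _ _ _ h, h]

section Chains

variable {t1 t2 t3 t4} {r1 r2 r3 r4}

/-- The number of basis vectors in the chain of a nilpotent summand. -/
def chainLength (r1 : Fin t1 → ℕ) (r2 : Fin t2 → ℕ) (r3 : Fin t3 → ℕ) (r4 : Fin t4 → ℕ) :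
    Fin t1 ⊕ (Fin t2 ⊕ (Fin t3 ⊕ Fin t4)) → ℕ
  | Sum.inl j => 2 * r1 j
  | Sum.inr (Sum.inl j) => 2 * r2 j
  | Sum.inr (Sum.inr (Sum.inl j)) => 2 * r3 j - 1
  | Sum.inr (Sum.inr (Sum.inr j)) => 2 * r4 j - 1

/-- `0` if the chain of a nilpotent summand ends in the space `U`, and `1` if it ends in `V`. -/
def chainSide : Fin t1 ⊕ (Fin t2 ⊕ (Fin t3 ⊕ Fin t4)) → ℕ
  | Sum.inl _ => 0
  | Sum.inr (Sum.inl _) => 1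
  | Sum.inr (Sum.inr (Sum.inl _)) => 0
  | Sum.inr (Sum.inr (Sum.inr _)) => 1

/-- Index set of the nilpotent part of `U`. -/
abbrev NilU (r1 : Fin t1 → ℕ) (r2 : Fin t2 → ℕ) (r3 : Fin t3 → ℕ) (r4 : Fin t4 → ℕ) :=
  (Σ j : Fin t1, Fin (r1 j)) ⊕ ((Σ j : Fin t2, Fin (r2 j)) ⊕
    ((Σ j : Fin t3, Fin (r3 j)) ⊕ (Σ j : Fin t4, Fin (r4 j - 1))))

/-- Index set of the nilpotent part of `V`. -/
abbrev NilV (r1 : Fin t1 → ℕ) (r2 : Fin t2 → ℕ) (r3 : Fin t3 → ℕ) (r4 : Fin t4 → ℕ) :=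
  (Σ j : Fin t1, Fin (r1 j)) ⊕ ((Σ j : Fin t2, Fin (r2 j)) ⊕
    ((Σ j : Fin t3, Fin (r3 j - 1)) ⊕ (Σ j : Fin t4, Fin (r4 j))))

/-- The place of a basis vector in the chain it belongs to. -/
def chainPos : NilU r1 r2 r3 r4 ⊕ NilV r1 r2 r3 r4 → Σ τ, Fin (chainLength r1 r2 r3 r4 τ)
  | Sum.inl (Sum.inl ⟨j, a⟩) => ⟨Sum.inl j, 2 * a, by simp only [chainLength]; omega⟩
  | Sum.inl (Sum.inr (Sum.inl ⟨j, a⟩)) =>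
      ⟨Sum.inr (Sum.inl j), 2 * a + 1, by simp only [chainLength]; omega⟩
  | Sum.inl (Sum.inr (Sum.inr (Sum.inl ⟨j, a⟩))) =>
      ⟨Sum.inr (Sum.inr (Sum.inl j)), 2 * a, by simp only [chainLength]; omega⟩
  | Sum.inl (Sum.inr (Sum.inr (Sum.inr ⟨j, a⟩))) =>
      ⟨Sum.inr (Sum.inr (Sum.inr j)), 2 * a + 1, by simp only [chainLength]; omega⟩
  | Sum.inr (Sum.inl ⟨j, a⟩) => ⟨Sum.inl j, 2 * a + 1, by simp only [chainLength]; omega⟩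
  | Sum.inr (Sum.inr (Sum.inl ⟨j, a⟩)) =>
      ⟨Sum.inr (Sum.inl j), 2 * a, by simp only [chainLength]; omega⟩
  | Sum.inr (Sum.inr (Sum.inr (Sum.inl ⟨j, a⟩))) =>
      ⟨Sum.inr (Sum.inr (Sum.inl j)), 2 * a + 1, by simp only [chainLength]; omega⟩
  | Sum.inr (Sum.inr (Sum.inr (Sum.inr ⟨j, a⟩))) =>
      ⟨Sum.inr (Sum.inr (Sum.inr j)), 2 * a, by simp only [chainLength]; omega⟩

lemma chainPos_injective :
    Function.Injective (chainPos (r1 := r1) (r2 := r2) (r3 := r3) (r4 := r4)) := by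
  intro x y h
  have h1 : (chainPos x).1 = (chainPos y).1 := congrArg Sigma.fst h
  have h2 : ((chainPos x).2 : ℕ) = (chainPos y).2 :=
    congrArg (fun z : Σ τ, Fin (chainLength r1 r2 r3 r4 τ) => (z.2 : ℕ)) h
  clear h
  rcases x with (⟨j, a⟩ | ⟨j, a⟩ | ⟨j, a⟩ | ⟨j, a⟩) | (⟨j, a⟩ | ⟨j, a⟩ | ⟨j, a⟩ | ⟨j, a⟩) <;>
  rcases y with (⟨j', b⟩ | ⟨j', b⟩ | ⟨j', b⟩ | ⟨j', b⟩) |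
    (⟨j', b⟩ | ⟨j', b⟩ | ⟨j', b⟩ | ⟨j', b⟩) <;>
  simp only [chainPos, Sum.inl.injEq, Sum.inr.injEq, reduceCtorEq] at h1 h2 <;>
  first
  | omega
  | (subst h1
     obtain rfl : a = b := Fin.ext (by omega)
     rfl)

lemma chainPos_surjective :
    Function.Surjective (chainPos (r1 := r1) (r2 := r2) (r3 := r3) (r4 := r4)) := by
  rintro ⟨j | j | j | j, k, hk⟩ <;> obtain ⟨a, rfl | rfl⟩ := Nat.even_or_odd' k <;>
    simp only [chainLength] at hk
  · exact ⟨Sum.inl (Sum.inl ⟨j, a, by omega⟩), rfl⟩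
  · exact ⟨Sum.inr (Sum.inl ⟨j, a, by omega⟩), rfl⟩
  · exact ⟨Sum.inr (Sum.inr (Sum.inl ⟨j, a, by omega⟩)), rfl⟩
  · exact ⟨Sum.inl (Sum.inr (Sum.inl ⟨j, a, by omega⟩)), rfl⟩
  · exact ⟨Sum.inl (Sum.inr (Sum.inr (Sum.inl ⟨j, a, by omega⟩))), rfl⟩
  · exact ⟨Sum.inr (Sum.inr (Sum.inr (Sum.inl ⟨j, a, by omega⟩))), rfl⟩
  · exact ⟨Sum.inr (Sum.inr (Sum.inr (Sum.inr ⟨j, a, by omega⟩))), rfl⟩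
  · exact ⟨Sum.inl (Sum.inr (Sum.inr (Sum.inr ⟨j, a, by omega⟩))), rfl⟩

/-- The basis of the nilpotent part of `U ⊕ V`, arranged in chains. -/
noncomputable def chainEquiv :
    NilU r1 r2 r3 r4 ⊕ NilV r1 r2 r3 r4 ≃ Σ τ, Fin (chainLength r1 r2 r3 r4 τ) :=
  Equiv.ofBijective chainPos ⟨chainPos_injective, chainPos_surjective⟩

/-- The support of the deformation in terms of positions in chains. -/
def chainSupp (r1 : Fin t1 → ℕ) (r2 : Fin t2 → ℕ) (r3 : Fin t3 → ℕ) (r4 : Fin t4 → ℕ) :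
    Fin t1 ⊕ (Fin t2 ⊕ (Fin t3 ⊕ Fin t4)) → Fin t1 ⊕ (Fin t2 ⊕ (Fin t3 ⊕ Fin t4)) →
      ℕ → ℕ → Prop
  | Sum.inl j, Sum.inl j', k, l =>
      k % 2 = 1 ∧ l % 2 = 0 ∧ Hcond (r1 j) (r1 j') (k / 2) (l / 2)
  | Sum.inl j, Sum.inr (Sum.inl j'), k, l =>
      k % 2 = 1 ∧ l % 2 = 1 ∧ Hcond (r1 j) (r2 j') (k / 2) (l / 2)
  | Sum.inl j, Sum.inr (Sum.inr (Sum.inl j')), k, l =>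
      k % 2 = 1 ∧ l % 2 = 0 ∧ Hcond (r1 j) (r3 j') (k / 2) (l / 2)
  | Sum.inl j, Sum.inr (Sum.inr (Sum.inr j')), k, l =>
      k % 2 = 1 ∧ l % 2 = 1 ∧ Hcond (r1 j) (r4 j' - 1) (k / 2) (l / 2)
  | Sum.inr (Sum.inl j), Sum.inl j', k, l =>
      k % 2 = 0 ∧ l % 2 = 0 ∧ Hcond (r2 j) (r1 j') (k / 2) (l / 2)
  | Sum.inr (Sum.inr (Sum.inl j)), Sum.inl j', k, l =>
      k % 2 = 1 ∧ l % 2 = 0 ∧ Hcond (r3 j - 1) (r1 j') (k / 2) (l / 2)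
  | Sum.inr (Sum.inr (Sum.inr j)), Sum.inl j', k, l =>
      k % 2 = 0 ∧ l % 2 = 0 ∧ Hcond (r4 j) (r1 j') (k / 2) (l / 2)
  | Sum.inr (Sum.inl j), Sum.inr (Sum.inl j'), k, l =>
      k % 2 = 1 ∧ l % 2 = 0 ∧ Hcond (r2 j) (r2 j') (k / 2) (l / 2)
  | Sum.inr (Sum.inl j), Sum.inr (Sum.inr (Sum.inl j')), k, l =>
      k % 2 = 1 ∧ l % 2 = 1 ∧ Hcond (r2 j) (r3 j' - 1) (k / 2) (l / 2)
  | Sum.inr (Sum.inl j), Sum.inr (Sum.inr (Sum.inr j')), k, l =>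
      k % 2 = 1 ∧ l % 2 = 0 ∧ Hcond (r2 j) (r4 j') (k / 2) (l / 2)
  | Sum.inr (Sum.inr (Sum.inl j)), Sum.inr (Sum.inl j'), k, l =>
      k % 2 = 0 ∧ l % 2 = 0 ∧ Hcond (r3 j) (r2 j') (k / 2) (l / 2)
  | Sum.inr (Sum.inr (Sum.inr j)), Sum.inr (Sum.inl j'), k, l =>
      k % 2 = 1 ∧ l % 2 = 0 ∧ Hcond (r4 j - 1) (r2 j') (k / 2) (l / 2)
  | Sum.inr (Sum.inr (Sum.inl j)), Sum.inr (Sum.inr (Sum.inl j')), k, l =>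
      (k % 2 = 0 ∧ l % 2 = 1 ∧ (j : ℕ) ≤ j' ∧ Hcond (r3 j) (r3 j' - 1) (k / 2) (l / 2)) ∨
      (k % 2 = 1 ∧ l % 2 = 0 ∧ (j' : ℕ) < j ∧ Hcond (r3 j - 1) (r3 j') (k / 2) (l / 2))
  | Sum.inr (Sum.inr (Sum.inl j)), Sum.inr (Sum.inr (Sum.inr j')), k, l =>
      k % 2 = 0 ∧ l % 2 = 0 ∧ Hcond (r3 j) (r4 j') (k / 2) (l / 2)
  | Sum.inr (Sum.inr (Sum.inr j)), Sum.inr (Sum.inr (Sum.inl j')), k, l =>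
      k % 2 = 0 ∧ l % 2 = 0 ∧ Hcond (r4 j) (r3 j') (k / 2) (l / 2)
  | Sum.inr (Sum.inr (Sum.inr j)), Sum.inr (Sum.inr (Sum.inr j')), k, l =>
      (k % 2 = 1 ∧ l % 2 = 0 ∧ (j' : ℕ) < j ∧ Hcond (r4 j - 1) (r4 j') (k / 2) (l / 2)) ∨
      (k % 2 = 0 ∧ l % 2 = 1 ∧ (j : ℕ) ≤ j' ∧ Hcond (r4 j) (r4 j' - 1) (k / 2) (l / 2))

lemma hcond_iff {rows cols a b : ℕ} :
    Hcond rows cols a b ↔ (rows ≤ cols ∧ b = 0) ∨ (cols < rows ∧ a = rows - 1) := by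
  unfold Hcond
  split_ifs <;> omega

lemma isTransversal_hcond (m n : ℕ) : IsTransversal m n (fun _ _ => True) (Hcond m n) where
  mem_diag k l hk hl h := by rw [hcond_iff] at h; omega
  unique k l k' l' hk hl hk' hl' h h' hd := by rw [hcond_iff] at h h'; omega
  exists_mem k l hk hl _ h1 h2 := by
    simp only [hcond_iff]
    by_cases h : m ≤ n
    · exact ⟨k - l, 0, by omega⟩
    · exact ⟨m - 1, m - 1 + l - k, by omega⟩

set_option maxHeartbeats 2000000 in
lemma isTransversal_chainSupp (hr3m : ∀ j j' : Fin t3, j ≤ j' → r3 j' ≤ r3 j)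
    (hr4m : ∀ j j' : Fin t4, j ≤ j' → r4 j' ≤ r4 j)
    (τ τ' : Fin t1 ⊕ (Fin t2 ⊕ (Fin t3 ⊕ Fin t4))) :
    IsTransversal (chainLength r1 r2 r3 r4 τ) (chainLength r1 r2 r3 r4 τ')
      (fun k l => (chainSide τ + k + chainSide τ' + l) % 2 = 1) (chainSupp r1 r2 r3 r4 τ τ') := by
  have h3 : ∀ j j' : Fin t3, (j : ℕ) ≤ j' → r3 j' ≤ r3 j := fun j j' h => hr3m j j' h
  have h4 : ∀ j j' : Fin t4, (j : ℕ) ≤ j' → r4 j' ≤ r4 j := fun j j' h => hr4m j j' h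
  constructor
  · intro k l hk hl h
    rcases τ with j | j | j | j <;> rcases τ' with j' | j' | j' | j' <;>
      simp only [chainLength, chainSupp, hcond_iff] at hk hl h ⊢ <;>
      first
      | omega
      | (have a3 := h3 j j'; have b3 := h3 j' j; omega)
      | (have a4 := h4 j j'; have b4 := h4 j' j; omega)
  · intro k l k' l' hk hl hk' hl' h h' hd
    rcases τ with j | j | j | j <;> rcases τ' with j' | j' | j' | j' <;>
      simp only [chainLength, chainSupp, hcond_iff] at hk hl hk' hl' h h' <;>
      omega
  · intro k l hk hl hok h1 h2
    suffices h : ∀ m n : ℕ, m = chainLength r1 r2 r3 r4 τ → n = chainLength r1 r2 r3 r4 τ' →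
        chainSupp r1 r2 r3 r4 τ τ' (k - l) 0 ∨
        (2 ≤ n ∧ k - l + 1 < m ∧ chainSupp r1 r2 r3 r4 τ τ' (k - l + 1) 1) ∨
        (l + m - 1 - k < n ∧ chainSupp r1 r2 r3 r4 τ τ' (m - 1) (l + m - 1 - k)) ∨
        (2 ≤ m ∧ k + 2 ≤ l + m ∧ chainSupp r1 r2 r3 r4 τ τ' (m - 2) (l + m - 2 - k)) by
      rcases h _ _ rfl rfl with h | ⟨_, _, h⟩ | ⟨_, h⟩ | ⟨_, _, h⟩
      · exact ⟨_, _, by omega, by omega, h, by omega⟩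
      · exact ⟨_, _, by omega, by omega, h, by omega⟩
      · exact ⟨_, _, by omega, by omega, h, by omega⟩
      · exact ⟨_, _, by omega, by omega, h, by omega⟩
    intro m n hm hn
    rcases τ with j | j | j | j <;> rcases τ' with j' | j' | j' | j' <;>
      rcases Nat.lt_or_ge j' j with hj | hj <;>
      simp only [chainLength, chainSupp, chainSide, Hcond] at hk hl hok h1 h2 hm hn ⊢ <;>
      (try have a3 := h3 j j') <;> (try have b3 := h3 j' j) <;>
      (try have a4 := h4 j j') <;> (try have b4 := h4 j' j) <;>
      split_ifs <;> (try simp only [and_true, true_and]) <;>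
      first
      | (refine Or.inl ?_; omega)
      | (refine Or.inr (Or.inl ?_); omega)
      | (refine Or.inr (Or.inr (Or.inl ?_)); omega)
      | (refine Or.inr (Or.inr (Or.inr ?_)); omega)

lemma jordanEntry_zero (a b : ℕ) : jordanEntry 0 a b = if b = a + 1 then 1 else 0 := by
  unfold jordanEntry
  split_ifs <;> first | rfl | omega

lemma jordanMatrix_submatrix_chainEquiv :
    (jordanMatrix (chainLength r1 r2 r3 r4) 0).submatrix chainEquiv chainEquiv =
      fromBlocks 0 (A t1 t2 t3 t4 r1 r2 r3 r4 s tC szC).toBlocks₂₂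
        (B t1 t2 t3 t4 r1 r2 r3 r4 s lamC tC szC).toBlocks₂₂ 0 := by
  ext x y
  rw [Matrix.submatrix_apply, jordanMatrix_apply]
  change (if (chainPos x).1 = (chainPos y).1 then
    jordanEntry 0 (chainPos x).2 (chainPos y).2 else 0) = _
  rcases x with (⟨j, a⟩ | ⟨j, a⟩ | ⟨j, a⟩ | ⟨j, a⟩) | (⟨j, a⟩ | ⟨j, a⟩ | ⟨j, a⟩ | ⟨j, a⟩) <;>
  rcases y with (⟨j', b⟩ | ⟨j', b⟩ | ⟨j', b⟩ | ⟨j', b⟩) |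
    (⟨j', b⟩ | ⟨j', b⟩ | ⟨j', b⟩ | ⟨j', b⟩) <;>
  simp only [chainPos, jordanEntry_zero, A, B, Matrix.toBlocks₂₂, Matrix.of_apply,
    Matrix.fromBlocks_apply₁₁, Matrix.fromBlocks_apply₁₂, Matrix.fromBlocks_apply₂₁,
    Matrix.fromBlocks_apply₂₂, Matrix.zero_apply, Sum.inl.injEq, Sum.inr.injEq,
    reduceCtorEq, if_false] <;>
  first
  | rfl
  | (by_cases hj : j = j' <;> simp only [hj, true_and, false_and, if_true, if_false, eq_self]
     split_ifs <;> first | rfl | omega)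

lemma isNilpotent_submatrix {K K' : Type*} [Fintype K] [Fintype K'] [DecidableEq K]
    [DecidableEq K'] {J : Matrix K K ℂ} (h : IsNilpotent J) (e : K' ≃ K) :
    IsNilpotent (J.submatrix e e) :=
  h.map (Matrix.reindexAlgEquiv ℂ ℂ e.symm)

lemma isUnit_submatrix {K K' : Type*} [Fintype K] [Fintype K'] [DecidableEq K]
    [DecidableEq K'] {J : Matrix K K ℂ} (h : IsUnit J) (e : K' ≃ K) :
    IsUnit (J.submatrix e e) :=
  h.map (Matrix.reindexAlgEquiv ℂ ℂ e.symm)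

lemma pSupp_inr_iff (x : NilU r1 r2 r3 r4) (y : NilV r1 r2 r3 r4) :
    PSupp t1 t2 t3 t4 r1 r2 r3 r4 s tC szC (Sum.inr x) (Sum.inr y) ↔
      chainSupp r1 r2 r3 r4 (chainPos (Sum.inl x)).1 (chainPos (Sum.inr y)).1
        (chainPos (Sum.inl x)).2 (chainPos (Sum.inr y)).2 := by
  rcases x with ⟨j, a⟩ | ⟨j, a⟩ | ⟨j, a⟩ | ⟨j, a⟩ <;>
  rcases y with ⟨j', b⟩ | ⟨j', b⟩ | ⟨j', b⟩ | ⟨j', b⟩ <;>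
  simp [PSupp, chainSupp, chainPos, Nat.mul_add_div]

lemma qSupp_inr_iff (x : NilV r1 r2 r3 r4) (y : NilU r1 r2 r3 r4) :
    QSupp t1 t2 t3 t4 r1 r2 r3 r4 s tC szC (Sum.inr x) (Sum.inr y) ↔
      chainSupp r1 r2 r3 r4 (chainPos (Sum.inr x)).1 (chainPos (Sum.inl y)).1
        (chainPos (Sum.inr x)).2 (chainPos (Sum.inl y)).2 := by
  rcases x with ⟨j, a⟩ | ⟨j, a⟩ | ⟨j, a⟩ | ⟨j, a⟩ <;>
  rcases y with ⟨j', b⟩ | ⟨j', b⟩ | ⟨j', b⟩ | ⟨j', b⟩ <;>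
  simp [QSupp, chainSupp, chainPos, Nat.mul_add_div]

lemma isMiniversal_nilpotent (hr3m : ∀ j j' : Fin t3, j ≤ j' → r3 j' ≤ r3 j)
    (hr4m : ∀ j j' : Fin t4, j ≤ j' → r4 j' ≤ r4 j) :
    IsMiniversal (A t1 t2 t3 t4 r1 r2 r3 r4 s tC szC).toBlocks₂₂
      (B t1 t2 t3 t4 r1 r2 r3 r4 s lamC tC szC).toBlocks₂₂
      (fun x y => PSupp t1 t2 t3 t4 r1 r2 r3 r4 s tC szC (Sum.inr x) (Sum.inr y))
      (fun x y => QSupp t1 t2 t3 t4 r1 r2 r3 r4 s tC szC (Sum.inr x) (Sum.inr y)) := by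
  have h := (isComplement_jordanMatrix (L := chainLength r1 r2 r3 r4) 0
    (fun τ τ' k l => (chainSide τ + k + chainSide τ' + l) % 2 = 1) (chainSupp r1 r2 r3 r4)
    (fun τ τ' _ => isTransversal_chainSupp hr3m hr4m τ τ') (fun _ _ _ _ _ => rfl)).submatrix
    chainEquiv
  rw [jordanMatrix_submatrix_chainEquiv s lamC tC szC] at h
  simp only [pSupp_inr_iff, qSupp_inr_iff]
  refine h.isMiniversal (fun x y => ?_) (fun x y => ?_)
  · change (chainSide (chainPos (Sum.inl x)).1 + (chainPos (Sum.inl x)).2 +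
      chainSide (chainPos (Sum.inr y)).1 + (chainPos (Sum.inr y)).2) % 2 = 1
    rcases x with ⟨j, a⟩ | ⟨j, a⟩ | ⟨j, a⟩ | ⟨j, a⟩ <;>
    rcases y with ⟨j', b⟩ | ⟨j', b⟩ | ⟨j', b⟩ | ⟨j', b⟩ <;>
    simp only [chainPos, chainSide] <;> omega
  · change (chainSide (chainPos (Sum.inr x)).1 + (chainPos (Sum.inr x)).2 +
      chainSide (chainPos (Sum.inl y)).1 + (chainPos (Sum.inl y)).2) % 2 = 1
    rcases x with ⟨j, a⟩ | ⟨j, a⟩ | ⟨j, a⟩ | ⟨j, a⟩ <;>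
    rcases y with ⟨j', b⟩ | ⟨j', b⟩ | ⟨j', b⟩ | ⟨j', b⟩ <;>
    simp only [chainPos, chainSide] <;> omega

lemma jordanMatrix_submatrix_sigmaAssoc :
    (jordanMatrix (fun p : Σ i, Fin (tC i) => szC p.1 p.2) (fun p => lamC p.1)).submatrix
      (Equiv.sigmaAssoc fun i j => Fin (szC i j)).symm
      (Equiv.sigmaAssoc fun i j => Fin (szC i j)).symm =
      (B t1 t2 t3 t4 r1 r2 r3 r4 s lamC tC szC).toBlocks₁₁ := by
  ext ⟨i, j, a⟩ ⟨i', j', b⟩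
  simp only [Matrix.submatrix_apply, jordanMatrix_apply, Equiv.sigmaAssoc, Equiv.coe_fn_symm_mk,
    B, Matrix.toBlocks₁₁, Matrix.of_apply]
  refine if_congr ?_ rfl rfl
  constructor
  · intro h
    cases h
    simp
  · rintro ⟨h, h'⟩
    change i = i' at h
    change (j : ℕ) = j' at h'
    subst h
    rw [Fin.ext h']

lemma isMiniversal_jordan (hlam : Function.Injective lamC) :
    IsMiniversal 1 (B t1 t2 t3 t4 r1 r2 r3 r4 s lamC tC szC).toBlocks₁₁ (fun _ _ => False)
      (fun x y => QSupp t1 t2 t3 t4 r1 r2 r3 r4 s tC szC (Sum.inl x) (Sum.inl y)) := by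
  have h := (isComplement_jordanMatrix (L := fun p : Σ i, Fin (tC i) => szC p.1 p.2)
    (fun p => lamC p.1) (fun _ _ _ _ => True)
    (fun p p' k l => p.1 = p'.1 ∧ Hcond (szC p.1 p.2) (szC p'.1 p'.2) k l)
    (fun p p' hp => by simpa [hlam hp] using isTransversal_hcond _ _)
    (fun p p' k l hp => congrArg lamC hp.1)).submatrix
    (Equiv.sigmaAssoc fun i j => Fin (szC i j)).symm
  rw [jordanMatrix_submatrix_sigmaAssoc] at h
  exact h.isMiniversal_one

lemma isMiniversal_A_B (hlam : Function.Injective lamC) (hlam0 : ∀ i, lamC i ≠ 0)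
    (hr3m : ∀ j j' : Fin t3, j ≤ j' → r3 j' ≤ r3 j)
    (hr4m : ∀ j j' : Fin t4, j ≤ j' → r4 j' ≤ r4 j) :
    IsMiniversal (A t1 t2 t3 t4 r1 r2 r3 r4 s tC szC) (B t1 t2 t3 t4 r1 r2 r3 r4 s lamC tC szC)
      (PSupp t1 t2 t3 t4 r1 r2 r3 r4 s tC szC) (QSupp t1 t2 t3 t4 r1 r2 r3 r4 s tC szC) := by
  have hA : A t1 t2 t3 t4 r1 r2 r3 r4 s tC szC =
      fromBlocks 1 0 0 (A t1 t2 t3 t4 r1 r2 r3 r4 s tC szC).toBlocks₂₂ := by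
    ext (x | x) (y | y)
    · rw [Matrix.fromBlocks_apply₁₁, Matrix.one_apply]
      rfl
    · rfl
    · rcases x with x | x | x | x <;> rfl
    · rfl
  have hB : B t1 t2 t3 t4 r1 r2 r3 r4 s lamC tC szC =
      fromBlocks (B t1 t2 t3 t4 r1 r2 r3 r4 s lamC tC szC).toBlocks₁₁ 0 0
        (B t1 t2 t3 t4 r1 r2 r3 r4 s lamC tC szC).toBlocks₂₂ := by
    ext (x | x) (y | y)
    · rfl
    · rfl
    · rcases x with x | x | x | x <;> rfl
    · rfl
  have hN := isNilpotent_submatrix (isNilpotent_jordanMatrix (chainLength r1 r2 r3 r4)) chainEquiv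
  rw [jordanMatrix_submatrix_chainEquiv s lamC tC szC] at hN
  have hU := isUnit_submatrix
    (isUnit_jordanMatrix (fun p : Σ i, Fin (tC i) => szC p.1 p.2) (fun p => lamC p.1)
      fun p => hlam0 p.1) (Equiv.sigmaAssoc fun i j => Fin (szC i j)).symm
  rw [jordanMatrix_submatrix_sigmaAssoc (r1 := r1) (r2 := r2) (r3 := r3) (r4 := r4)] at hU
  rw [hA, hB]
  refine (isMiniversal_jordan s lamC tC szC hlam).fromBlocks
    (isMiniversal_nilpotent s lamC tC szC hr3m hr4m) hU
    (isNilpotent_of_fromBlocks hN).1 (isNilpotent_of_fromBlocks hN).2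
    (fun _ _ => Iff.rfl) (fun _ _ => Iff.rfl) (fun _ _ => Iff.rfl) (fun _ _ => Iff.rfl)
    ?_ ?_ ?_ ?_
  · exact fun _ _ => id
  · rintro (x | x | x | x) _ <;> exact id
  · exact fun _ _ => id
  · rintro (x | x | x | x) _ <;> exact id

end Chains

/-- Theorem 4.1 of the paper over `ℂ`: `ℂ^{m×n} × ℂ^{n×m}` is the internal direct sum of
the coordinate subspace `𝒫` (supported on `PSupp`, `QSupp`) and the tangent space
`{(SA − AR, RB − BS)}`: every pair `(M, N)` decomposes, uniquely, as a sum of the two. -/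
theorem simplest_miniversal_contragredient_complex
    (hlam : Function.Injective lamC) (hlam0 : ∀ i, lamC i ≠ 0)
    (hszC1 : ∀ i j, 1 ≤ szC i j)
    (hszCmono : ∀ (i : Fin s) (j j' : Fin (tC i)), j ≤ j' → szC i j' ≤ szC i j)
    (hr1 : ∀ j, 1 ≤ r1 j) (hr1m : ∀ j j' : Fin t1, j ≤ j' → r1 j' ≤ r1 j)
    (hr2 : ∀ j, 1 ≤ r2 j) (hr2m : ∀ j j' : Fin t2, j ≤ j' → r2 j' ≤ r2 j)
    (hr3 : ∀ j, 1 ≤ r3 j) (hr3m : ∀ j j' : Fin t3, j ≤ j' → r3 j' ≤ r3 j)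
    (hr4 : ∀ j, 1 ≤ r4 j) (hr4m : ∀ j j' : Fin t4, j ≤ j' → r4 j' ≤ r4 j) :
    (∀ (M : Matrix (Mi t1 t2 t3 t4 r1 r2 r3 r4 s tC szC) (Ni t1 t2 t3 t4 r1 r2 r3 r4 s tC szC) ℂ)
       (N : Matrix (Ni t1 t2 t3 t4 r1 r2 r3 r4 s tC szC) (Mi t1 t2 t3 t4 r1 r2 r3 r4 s tC szC) ℂ),
      ∃ (P : Matrix (Mi t1 t2 t3 t4 r1 r2 r3 r4 s tC szC) (Ni t1 t2 t3 t4 r1 r2 r3 r4 s tC szC) ℂ)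
        (Q : Matrix (Ni t1 t2 t3 t4 r1 r2 r3 r4 s tC szC) (Mi t1 t2 t3 t4 r1 r2 r3 r4 s tC szC) ℂ)
        (S : Matrix (Mi t1 t2 t3 t4 r1 r2 r3 r4 s tC szC) (Mi t1 t2 t3 t4 r1 r2 r3 r4 s tC szC) ℂ)
        (R : Matrix (Ni t1 t2 t3 t4 r1 r2 r3 r4 s tC szC) (Ni t1 t2 t3 t4 r1 r2 r3 r4 s tC szC) ℂ),
        (∀ x y, ¬ PSupp t1 t2 t3 t4 r1 r2 r3 r4 s tC szC x y → P x y = 0) ∧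
        (∀ x y, ¬ QSupp t1 t2 t3 t4 r1 r2 r3 r4 s tC szC x y → Q x y = 0) ∧
        M = P + (S * A t1 t2 t3 t4 r1 r2 r3 r4 s tC szC
                  - A t1 t2 t3 t4 r1 r2 r3 r4 s tC szC * R) ∧
        N = Q + (R * B t1 t2 t3 t4 r1 r2 r3 r4 s lamC tC szC
                  - B t1 t2 t3 t4 r1 r2 r3 r4 s lamC tC szC * S)) ∧
    (∀ (P : Matrix (Mi t1 t2 t3 t4 r1 r2 r3 r4 s tC szC) (Ni t1 t2 t3 t4 r1 r2 r3 r4 s tC szC) ℂ)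
       (Q : Matrix (Ni t1 t2 t3 t4 r1 r2 r3 r4 s tC szC) (Mi t1 t2 t3 t4 r1 r2 r3 r4 s tC szC) ℂ)
       (S : Matrix (Mi t1 t2 t3 t4 r1 r2 r3 r4 s tC szC) (Mi t1 t2 t3 t4 r1 r2 r3 r4 s tC szC) ℂ)
       (R : Matrix (Ni t1 t2 t3 t4 r1 r2 r3 r4 s tC szC) (Ni t1 t2 t3 t4 r1 r2 r3 r4 s tC szC) ℂ),
        (∀ x y, ¬ PSupp t1 t2 t3 t4 r1 r2 r3 r4 s tC szC x y → P x y = 0) →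
        (∀ x y, ¬ QSupp t1 t2 t3 t4 r1 r2 r3 r4 s tC szC x y → Q x y = 0) →
        P + (S * A t1 t2 t3 t4 r1 r2 r3 r4 s tC szC
              - A t1 t2 t3 t4 r1 r2 r3 r4 s tC szC * R) = 0 →
        Q + (R * B t1 t2 t3 t4 r1 r2 r3 r4 s lamC tC szC
              - B t1 t2 t3 t4 r1 r2 r3 r4 s lamC tC szC * S) = 0 →
        P = 0 ∧ Q = 0 ∧
          S * A t1 t2 t3 t4 r1 r2 r3 r4 s tC szC
            - A t1 t2 t3 t4 r1 r2 r3 r4 s tC szC * R = 0 ∧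
          R * B t1 t2 t3 t4 r1 r2 r3 r4 s lamC tC szC
            - B t1 t2 t3 t4 r1 r2 r3 r4 s lamC tC szC * S = 0) := by
  have h := isMiniversal_A_B (r1 := r1) (r2 := r2) s lamC tC szC hlam hlam0 hr3m hr4m
  refine ⟨h.1, fun P Q S R hP hQ h1 h2 => ?_⟩
  obtain ⟨rfl, rfl⟩ := h.2 P Q S R hP hQ h1 h2
  exact ⟨rfl, rfl, by rwa [zero_add] at h1, by rwa [zero_add] at h2⟩

end ContragredientComplex
end
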